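/- Let G be an ICC countable group admitting a finite generating set S = {s₁,…,s_k} consisting of infinite-order elements such that for every i ∈ {1,…,k−1} the elements s_i and s_{i+1} commute, and such that s₁ has nonamenable centralizer in G. Let G ↷ X be a nontrivial Bernoulli action of G, let H be a countable group, and let H ↷ Y be a free ergodic measure-preserving action on a standard probability space. If the actions G ↷ X and H ↷ Y are orbit equivalent, then they are conjugate. -/

import Mathlib

open MeasureTheory
open scoped ENNReal Pointwise symmDiff

namespace OEPaper

/- ## Right-angled Artin groups and graph combinatorics -/

/-- The commutation relations defining the right-angled Artin group of a graph. -/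
def raagRels {V : Type} (Γ : SimpleGraph V) : Set (FreeGroup V) :=
  {r | ∃ u v : V, Γ.Adj u v ∧
    r = FreeGroup.of u * FreeGroup.of v * (FreeGroup.of u)⁻¹ * (FreeGroup.of v)⁻¹}

/-- The right-angled Artin group of a simple graph `Γ`. -/
abbrev RAAG {V : Type} (Γ : SimpleGraph V) : Type := PresentedGroup (raagRels Γ)

/-- The standard generator of `RAAG Γ` associated to a vertex. -/
def gen {V : Type} (Γ : SimpleGraph V) (v : V) : RAAG Γ := PresentedGroup.of v

/-- The standard subgroup associated to (the full subgraph spanned by) a set of vertices. -/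
def standardSub {V : Type} (Γ : SimpleGraph V) (S : Set V) : Subgroup (RAAG Γ) :=
  Subgroup.closure (gen Γ '' S)

/-- Conjugate of a subgroup. -/
def conjSub {G : Type} [Group G] (g : G) (P : Subgroup G) : Subgroup G :=
  Subgroup.map (MulAut.conj g).toMonoidHom P

/-- Parabolic subgroups: conjugates of standard subgroups. -/
def IsParabolic {V : Type} (Γ : SimpleGraph V) (P : Subgroup (RAAG Γ)) : Prop :=
  ∃ (g : RAAG Γ) (S : Set V), P = conjSub g (standardSub Γ S)

/-- The "orthogonal" of a set of vertices: vertices outside `S` adjacent to every vertex of `S`. -/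
def perp {V : Type} (Γ : SimpleGraph V) (S : Set V) : Set V :=
  {v : V | v ∉ S ∧ ∀ u ∈ S, Γ.Adj v u}

/-- `S` spans a join subgraph of `Γ`. -/
def IsJoin {V : Type} (Γ : SimpleGraph V) (S : Set V) : Prop :=
  ∃ S₁ S₂ : Set V, S₁.Nonempty ∧ S₂.Nonempty ∧ S₁ ∪ S₂ = S ∧ ∀ u ∈ S₁, ∀ v ∈ S₂, Γ.Adj u v

/-- `S` spans a maximal join subgraph of `Γ`. -/
def IsMaxJoin {V : Type} (Γ : SimpleGraph V) (S : Set V) : Prop :=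
  IsJoin Γ S ∧ ∀ T : Set V, IsJoin Γ T → S ⊆ T → S = T

/-- Join parabolic subgroups. -/
def IsJoinParabolic {V : Type} (Γ : SimpleGraph V) (P : Subgroup (RAAG Γ)) : Prop :=
  ∃ (g : RAAG Γ) (S : Set V), IsJoin Γ S ∧ P = conjSub g (standardSub Γ S)

/-- Maximal join parabolic subgroups. -/
def IsMaxJoinParabolic {V : Type} (Γ : SimpleGraph V) (P : Subgroup (RAAG Γ)) : Prop :=
  ∃ (g : RAAG Γ) (S : Set V), IsMaxJoin Γ S ∧ P = conjSub g (standardSub Γ S)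

/-- The center of a subgroup `P`, as a subset of the ambient group. -/
def subCenter {G : Type} [Group G] (P : Subgroup G) : Set G :=
  {x : G | x ∈ P ∧ ∀ y ∈ P, x * y = y * x}

/-- The commutation graph of a subset `S` of a group. -/
def chainCommGraph {G : Type} [Group G] (S : Set G) : SimpleGraph S :=
  SimpleGraph.fromRel fun a b => Commute (a : G) (b : G)

/-- A generating set is chain-commuting if its commutation graph is connected. -/
def IsChainCommuting {G : Type} [Group G] (S : Set G) : Prop :=
  (chainCommGraph S).Connected

/-- Amenability: existence of a finitely additive left-invariant probability
measure defined on all subsets. -/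
def IsAmenable (G : Type) [Group G] : Prop :=
  ∃ m : Set G → ℝ, m Set.univ = 1 ∧ (∀ A : Set G, 0 ≤ m A) ∧
    (∀ A B : Set G, Disjoint A B → m (A ∪ B) = m A + m B) ∧
    ∀ (g : G) (A : Set G), m ((g * ·) '' A) = m A

/-- ICC groups: every nontrivial element has an infinite conjugacy class. -/
def IsICC (G : Type) [Group G] : Prop :=
  ∀ g : G, g ≠ 1 → {h : G | ∃ c : G, c * g * c⁻¹ = h}.Infinite

/-- The root-conjugation property. -/
def RootConjugationProperty (H : Type) [Group H] : Prop :=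
  ∀ (h₁ h₂ : H) (k : ℕ), 0 < k → Commute h₁ (h₂ ^ k) → Commute h₁ h₂

/- ## Measured dynamics -/

/-- Measure-preserving action by measurable automorphisms. -/
def PmpAction (G : Type) [Group G] (X : Type) [MeasurableSpace X] [MulAction G X]
    (μ : Measure X) : Prop :=
  ∀ g : G, MeasurePreserving (fun x : X => g • x) μ μ

/-- Essentially free action. -/
def FreeAction (G : Type) [Group G] (X : Type) [MeasurableSpace X] [MulAction G X]
    (μ : Measure X) : Prop :=
  ∀ g : G, g ≠ 1 → μ {x : X | g • x = x} = 0

/-- Ergodic action of a group. -/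
def ErgodicAction (G : Type) [Group G] (X : Type) [MeasurableSpace X] [MulAction G X]
    (μ : Measure X) : Prop :=
  ∀ A : Set X, MeasurableSet A → (∀ g : G, (fun x : X => g • x) ⁻¹' A = A) →
    μ A = 0 ∨ μ A = 1

/-- Ergodicity of the action of a subgroup. -/
def ErgodicSubgroup (G : Type) [Group G] (A : Subgroup G) (X : Type) [MeasurableSpace X]
    [MulAction G X] (μ : Measure X) : Prop :=
  ∀ s : Set X, MeasurableSet s → (∀ a ∈ A, (fun x : X => a • x) ⁻¹' s = s) →
    μ s = 0 ∨ μ s = 1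

/-- Irreducible action of a right-angled Artin group: for some identification of the group
with a `RAAG Δ`, every standard generator acts ergodically. -/
def IrreducibleAction (G : Type) [Group G] (X : Type) [MeasurableSpace X] [MulAction G X]
    (μ : Measure X) : Prop :=
  ∃ (n : ℕ) (Δ : SimpleGraph (Fin n)) (e : RAAG Δ ≃* G),
    ∀ v : Fin n, Ergodic (fun x : X => e (gen Δ v) • x) μ

/-- A measure space isomorphism (mod null sets): a measurable measure-preserving map
admitting an a.e. two-sided measurable inverse. -/
def MeasIso {A : Type} {B : Type} [MeasurableSpace A] [MeasurableSpace B]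
    (μ : Measure A) (ν : Measure B) (F : A → B) : Prop :=
  Measurable F ∧ MeasurePreserving F μ ν ∧
    ∃ F' : B → A, Measurable F' ∧ (∀ᵐ a ∂μ, F' (F a) = a) ∧ ∀ᵐ b ∂ν, F (F' b) = b

/-- Conjugacy of two actions through a given group isomorphism. -/
def ConjugateVia (G : Type) [Group G] (X : Type) [MeasurableSpace X] [MulAction G X]
    (H : Type) [Group H] (Y : Type) [MeasurableSpace Y] [MulAction H Y]
    (μ : Measure X) (ν : Measure Y) (α : G ≃* H) : Prop :=
  ∃ F : X → Y, MeasIso μ ν F ∧ ∀ g : G, ∀ᵐ x ∂μ, F (g • x) = α g • F x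

/-- Conjugacy of two actions. -/
def ConjugateActions (G : Type) [Group G] (X : Type) [MeasurableSpace X] [MulAction G X]
    (H : Type) [Group H] (Y : Type) [MeasurableSpace Y] [MulAction H Y]
    (μ : Measure X) (ν : Measure Y) : Prop :=
  ∃ α : G ≃* H, ConjugateVia G X H Y μ ν α

/-- Orbit equivalence of two actions. -/
def OrbitEquivalent (G : Type) [Group G] (X : Type) [MeasurableSpace X] [MulAction G X]
    (H : Type) [Group H] (Y : Type) [MeasurableSpace Y] [MulAction H Y]
    (μ : Measure X) (ν : Measure Y) : Prop :=
  ∃ F : X → Y, MeasIso μ ν F ∧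
    ∀ᵐ x ∂μ, F '' MulAction.orbit G x = MulAction.orbit H (F x)

/-- Measurable cocycle for an action, with values in a (discrete) group `H`. -/
def IsCocycle (G : Type) [Group G] (X : Type) [MeasurableSpace X] [MulAction G X]
    (H : Type) [Group H] (μ : Measure X) (c : G → X → H) : Prop :=
  (∀ (g : G) (h : H), MeasurableSet {x : X | c g x = h}) ∧
    ∀ g g' : G, ∀ᵐ x ∂μ, c (g * g') x = c g (g' • x) * c g' x

/-- Cohomology of cocycles. -/
def Cohomologous (G : Type) [Group G] (X : Type) [MeasurableSpace X] [MulAction G X]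
    (H : Type) [Group H] (μ : Measure X) (c c' : G → X → H) : Prop :=
  ∃ φ : X → H, (∀ h : H, MeasurableSet {x : X | φ x = h}) ∧
    ∀ g : G, ∀ᵐ x ∂μ, c' g x = φ (g • x) * c g x * (φ x)⁻¹

/-- A stable orbit equivalence between two actions: a measure-scaling Borel isomorphism
between positive measure subsets, matching orbits. -/
structure StableOE (G : Type) [Group G] (X : Type) [MeasurableSpace X] [MulAction G X]
    (H : Type) [Group H] (Y : Type) [MeasurableSpace Y] [MulAction H Y]
    (μ : Measure X) (ν : Measure Y) where
  U : Set X
  V : Set Y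
  measU : MeasurableSet U
  measV : MeasurableSet V
  posU : 0 < μ U
  posV : 0 < ν V
  toFun : X → Y
  invFun : Y → X
  meas_toFun : Measurable toFun
  meas_invFun : Measurable invFun
  maps : Set.MapsTo toFun U V
  maps_inv : Set.MapsTo invFun V U
  left_inv : ∀ x ∈ U, invFun (toFun x) = x
  right_inv : ∀ y ∈ V, toFun (invFun y) = y
  pushforward : ∀ B : Set Y, B ⊆ V → MeasurableSet B →
    (μ U)⁻¹ * μ (U ∩ toFun ⁻¹' B) = (ν V)⁻¹ * ν B
  orbit_eq : ∀ᵐ x ∂μ, x ∈ U →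
    toFun '' (MulAction.orbit G x ∩ U) = MulAction.orbit H (toFun x) ∩ V

namespace StableOE

variable {G : Type} [Group G] {X : Type} [MeasurableSpace X] [MulAction G X]
  {H : Type} [Group H] {Y : Type} [MeasurableSpace Y] [MulAction H Y]
  {μ : Measure X} {ν : Measure Y}

/-- The compression constant of a stable orbit equivalence. -/
noncomputable def kappa (f : StableOE G X H Y μ ν) : ℝ≥0∞ := ν f.V / μ f.U

/-- `c` is an SOE cocycle associated to the stable orbit equivalence `f`. -/
def IsSOECocycle (f : StableOE G X H Y μ ν) (c : G → X → H) : Prop :=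
  IsCocycle G X H μ c ∧
    ∃ p : X → X, Measurable p ∧
      (∀ᵐ x ∂μ, p x ∈ f.U ∧ p x ∈ MulAction.orbit G x) ∧
      ∀ g : G, ∀ᵐ x ∂μ, f.toFun (p (g • x)) = c g x • f.toFun (p x)

end StableOE

/-- Mildly mixing action. -/
def MildlyMixing (H : Type) [Group H] (Y : Type) [MeasurableSpace Y] [MulAction H Y]
    (ν : Measure Y) : Prop :=
  ∀ A : Set Y, MeasurableSet A → ν A ≠ 0 → ν A ≠ ν Set.univ →
    ∀ u : ℕ → H, Function.Injective u →
      0 < Filter.atTop.liminf fun n => ν (((u n • ·) '' A) ∆ A)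

/- ## Virtual conjugacy -/

/-- `(Z, qact, ρ)` together with `π : X → Z` is a model for the quotient of the action
`G ↷ (X, μ)` by the normal subgroup `F`, with the induced `G ⧸ F`-action. -/
def IsQuotientModel {G : Type} [Group G] (F : Subgroup G) [F.Normal]
    {X : Type} [MeasurableSpace X] [MulAction G X] (μ : Measure X)
    {Z : Type} [MeasurableSpace Z] (qact : G ⧸ F →* Equiv.Perm Z) (ρ : Measure Z)
    (π : X → Z) : Prop :=
  Measurable π ∧ Measure.map π μ = ρ ∧
    (∀ (g : G) (x : X), π (g • x) = qact (QuotientGroup.mk g) (π x)) ∧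
    ∀ x y : X, π x = π y ↔ ∃ f ∈ F, f • x = y

/-- The action `act : Q →* Perm Z` on `(Z, ρ)` is (isomorphic to) the action induced from the
action `act' : K →* Perm X'` of the finite-index subgroup `K` on `(X', μ')`. -/
def InducedFrom {Q : Type} [Group Q] (K : Subgroup Q)
    {Z : Type} [MeasurableSpace Z] (act : Q →* Equiv.Perm Z) (ρ : Measure Z)
    {X' : Type} [MeasurableSpace X'] (act' : ↥K →* Equiv.Perm X') (μ' : Measure X') : Prop :=
  letI : MeasurableSpace (Q ⧸ K) := ⊤
  ∃ σ : Q ⧸ K → Q, (∀ k : Q ⧸ K, (QuotientGroup.mk (σ k) : Q ⧸ K) = k) ∧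
    ∃ Φ : X' × (Q ⧸ K) → Z,
      MeasIso (Measure.sum fun k : Q ⧸ K =>
        (K.index : ℝ≥0∞)⁻¹ • Measure.map (fun x' : X' => (x', k)) μ') ρ Φ ∧
      ∀ (g : Q) (k : Q ⧸ K) (h : ↥K), (h : Q) = (σ (g • k))⁻¹ * g * σ k →
        ∀ᵐ x' ∂μ', Φ (act' h x', g • k) = act g (Φ (x', k))

/-- Data witnessing that two probability measure-preserving actions are virtually
conjugate. -/
structure VirtualConjugacyData
    (G₁ : Type) [Group G₁] (X₁ : Type) [MeasurableSpace X₁] [MulAction G₁ X₁] (μ₁ : Measure X₁)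
    (G₂ : Type) [Group G₂] (X₂ : Type) [MeasurableSpace X₂] [MulAction G₂ X₂] (μ₂ : Measure X₂) :
    Type 1 where
  F₁ : Subgroup G₁
  F₂ : Subgroup G₂
  normal₁ : F₁.Normal
  normal₂ : F₂.Normal
  finite₁ : Finite F₁
  finite₂ : Finite F₂
  K₁ : Subgroup (G₁ ⧸ F₁)
  K₂ : Subgroup (G₂ ⧸ F₂)
  finiteIndex₁ : K₁.FiniteIndex
  finiteIndex₂ : K₂.FiniteIndex
  X'₁ : Type
  X'₂ : Type
  mX'₁ : MeasurableSpace X'₁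
  mX'₂ : MeasurableSpace X'₂
  μ'₁ : Measure X'₁
  μ'₂ : Measure X'₂
  prob₁ : IsProbabilityMeasure μ'₁
  prob₂ : IsProbabilityMeasure μ'₂
  act₁ : ↥K₁ →* Equiv.Perm X'₁
  act₂ : ↥K₂ →* Equiv.Perm X'₂
  pmp₁ : ∀ k : ↥K₁, MeasurePreserving (act₁ k) μ'₁ μ'₁
  pmp₂ : ∀ k : ↥K₂, MeasurePreserving (act₂ k) μ'₂ μ'₂
  θ : ↥K₁ ≃* ↥K₂
  conjF : X'₁ → X'₂
  conjF_iso : MeasIso μ'₁ μ'₂ conjF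
  conjF_equivariant : ∀ k : ↥K₁, ∀ᵐ x ∂μ'₁, conjF (act₁ k x) = act₂ (θ k) (conjF x)
  Z₁ : Type
  Z₂ : Type
  mZ₁ : MeasurableSpace Z₁
  mZ₂ : MeasurableSpace Z₂
  ρ₁ : Measure Z₁
  ρ₂ : Measure Z₂
  qact₁ : G₁ ⧸ F₁ →* Equiv.Perm Z₁
  qact₂ : G₂ ⧸ F₂ →* Equiv.Perm Z₂
  qpmp₁ : ∀ g, MeasurePreserving (qact₁ g) ρ₁ ρ₁
  qpmp₂ : ∀ g, MeasurePreserving (qact₂ g) ρ₂ ρ₂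
  π₁ : X₁ → Z₁
  π₂ : X₂ → Z₂
  quot₁ : IsQuotientModel F₁ μ₁ qact₁ ρ₁ π₁
  quot₂ : IsQuotientModel F₂ μ₂ qact₂ ρ₂ π₂
  ind₁ : InducedFrom K₁ qact₁ ρ₁ act₁ μ'₁
  ind₂ : InducedFrom K₂ qact₂ ρ₂ act₂ μ'₂

/- ## Bernoulli actions -/

/-- The Bernoulli shift action of `G` on `G → A`. -/
instance bernoulliAction (G A : Type) [Group G] : MulAction G (G → A) where
  smul g x := fun h => x (g⁻¹ * h)
  one_smul x := funext fun h => by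
    show x (1⁻¹ * h) = x h
    rw [inv_one, one_mul]
  mul_smul g g' x := funext fun h => by
    show x ((g * g')⁻¹ * h) = x (g'⁻¹ * (g⁻¹ * h))
    rw [mul_inv_rev, mul_assoc]

/-- `μ` is the product (Bernoulli) measure on `G → A` with base `μ₀`:
it gives the product value to every cylinder set. -/
def IsBernoulliMeasure (G : Type) [Group G] {A : Type} [MeasurableSpace A]
    (μ₀ : Measure A) (μ : Measure (G → A)) : Prop :=
  ∀ (s : Finset G) (B : G → Set A), (∀ g : G, MeasurableSet (B g)) →
    μ {x : G → A | ∀ g ∈ s, x g ∈ B g} = ∏ g ∈ s, μ₀ (B g)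


/-- `𝓕`-ergodicity: every subgroup in the collection `𝓕` acts ergodically. -/
def FErgodic (G : Type) [Group G] (𝓕 : Set (Subgroup G)) (X : Type) [MeasurableSpace X]
    [MulAction G X] (μ : Measure X) : Prop :=
  ∀ A ∈ 𝓕, ErgodicSubgroup G A X μ

/-- Strong cocycle-rigidity of the pair `(G, 𝓕)`. -/
def StronglyCocycleRigid (G : Type) [Group G] (𝓕 : Set (Subgroup G)) : Prop :=
  ∀ (X : Type) [MeasurableSpace X] [StandardBorelSpace X] (μ : Measure X)
    (Y : Type) [MeasurableSpace Y] [StandardBorelSpace Y] (ν : Measure Y)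
    [IsProbabilityMeasure μ] [IsProbabilityMeasure ν]
    [MulAction G X] [MulAction G Y],
    PmpAction G X μ → FreeAction G X μ → ErgodicAction G X μ → FErgodic G 𝓕 X μ →
    PmpAction G Y ν → FreeAction G Y ν → ErgodicAction G Y ν → FErgodic G 𝓕 Y ν →
    ∀ f : StableOE G X G Y μ ν, ∀ c : G → X → G, f.IsSOECocycle c →
      ∃ α : G ≃* G, Cohomologous G X G μ c fun g _ => α g

/- ## Nonamenability and spectral gap -/

/-- A group which admits, at every scale, finitely supported almost invariant unit vectors in `ℓ²`
is amenable. -/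
lemma isAmenable_of_almost_invariant (C : Type) [Group C]
    (h : ∀ (K : Finset C) (δ : ℝ), 0 < δ → ∃ x : C →₀ ℝ, ∑' c, x c ^ 2 = 1 ∧
      ∀ k ∈ K, ∑' c, (x (k * c) - x c) ^ 2 ≤ δ ^ 2) : IsAmenable C := by
  classical
  choose! x hx1 hx2 using h
  let δ : ℕ → ℝ := fun n => 1 / ((n : ℝ) + 1)
  have hδ : ∀ n, 0 < δ n := fun n => by positivity
  let F : Ultrafilter (Finset C × ℕ) := Ultrafilter.of Filter.atTop
  let m : Finset C × ℕ → Set C → ℝ := fun p E => ∑' c, E.indicator (fun c => x p.1 (δ p.2) c ^ 2) c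
  have hsum : ∀ (y : C →₀ ℝ) (E : Set C), Summable (E.indicator (fun c => y c ^ 2)) := by
    intro y E
    refine summable_of_hasFiniteSupport (y.support.finite_toSet.subset ?_)
    intro c hc
    simp only [Function.mem_support, Set.indicator_apply_ne_zero] at hc
    simpa using hc.2
  have hm0 : ∀ p E, 0 ≤ m p E := fun p E =>
    tsum_nonneg fun c => Set.indicator_nonneg (fun c _ => sq_nonneg _) c
  have hm1 : ∀ p E, m p E ≤ 1 := by
    intro p E
    rw [← hx1 p.1 (δ p.2) (hδ _)]
    refine (hsum _ E).tsum_le_tsum (fun c => Set.indicator_le_self' (fun _ _ => sq_nonneg _) c) ?_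
    simpa using hsum (x p.1 (δ p.2)) Set.univ
  have hlim : ∀ E, ∃ a, Filter.Tendsto (fun p => m p E) F (nhds a) := by
    intro E
    obtain ⟨a, -, ha⟩ := (isCompact_Icc (a := (0 : ℝ)) (b := 1)).ultrafilter_le_nhds
      (F.map fun p => m p E) (by
        simp only [Ultrafilter.coe_map, Filter.le_principal_iff, Filter.mem_map]
        exact Filter.univ_mem' fun p => ⟨hm0 p E, hm1 p E⟩)
    exact ⟨a, ha⟩
  choose M hM using hlim
  refine ⟨M, ?_, fun A => ge_of_tendsto' (hM A) fun p => hm0 p A, ?_, ?_⟩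
  · refine tendsto_nhds_unique (hM _) ?_
    simp only [m, Set.indicator_univ, hx1 _ _ (hδ _)]
    exact tendsto_const_nhds
  · intro A B hAB
    refine tendsto_nhds_unique (hM _) (((hM A).add (hM B)).congr fun p => ?_)
    simp only [m]
    rw [← (hsum _ A).tsum_add (hsum _ B), Set.indicator_union_of_disjoint hAB]
  · intro g A
    have key : ∀ᶠ p in (F : Filter (Finset C × ℕ)), |m p ((g * ·) '' A) - m p A| ≤
        5 / 2 * δ p.2 := by
      have : ∀ᶠ p in (Filter.atTop : Filter (Finset C × ℕ)), ({g}, 0) ≤ p :=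
        Filter.eventually_ge_atTop _
      filter_upwards [(Ultrafilter.of_le (Filter.atTop : Filter (Finset C × ℕ))) this] with p hp
      have hg : g ∈ p.1 := hp.1 (by simp)
      set y := x p.1 (δ p.2) with hy
      have hd := hδ p.2
      set d := δ p.2
      have hm' : m p ((g * ·) '' A) = ∑' c, A.indicator (fun c => y (g * c) ^ 2) c := by
        simp only [m]
        rw [← (Equiv.mulLeft g).tsum_eq]
        refine tsum_congr fun c => ?_
        by_cases hc : c ∈ A
        · rw [Set.indicator_of_mem hc, Set.indicator_of_mem]
          · rfl
          · exact ⟨c, hc, rfl⟩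
        · rw [Set.indicator_of_notMem hc, Set.indicator_of_notMem]
          rintro ⟨c', hc', h⟩
          exact hc (by rwa [← mul_left_cancel h])
      have hfs : ∀ f : C → ℝ, (∀ c, y c = 0 → y (g * c) = 0 → f c = 0) → Summable f := by
        intro f hf
        refine summable_of_hasFiniteSupport
          ((y.support ∪ y.support.image (g⁻¹ * ·)).finite_toSet.subset ?_)
        intro c hc
        by_contra hcc
        refine hc (hf c ?_ ?_)
        · by_contra h0
          exact hcc (by simp [h0])
        · by_contra h0
          refine hcc ?_
          simp only [Finset.coe_union, Finset.coe_image, Set.mem_union, Set.mem_image]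
          exact Or.inr ⟨g * c, by simpa using h0, by simp⟩
      have hN : ∑' c, y c ^ 2 = 1 := hx1 _ _ hd
      have hN' : ∑' c, y (g * c) ^ 2 = 1 := by
        rw [← hN]; exact (Equiv.mulLeft g).tsum_eq (fun c => y c ^ 2)
      have hD : ∑' c, (y (g * c) - y c) ^ 2 ≤ d ^ 2 := hx2 _ _ hd g hg
      have hptw : ∀ c, |A.indicator (fun c => y (g * c) ^ 2) c - A.indicator (fun c => y c ^ 2) c| ≤
          d * (y (g * c) ^ 2 + y c ^ 2) + 1 / (2 * d) * (y (g * c) - y c) ^ 2 := by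
        intro c
        have hpos : 0 ≤ d * (y (g * c) ^ 2 + y c ^ 2) + 1 / (2 * d) * (y (g * c) - y c) ^ 2 := by
          positivity
        by_cases hc : c ∈ A
        · simp only [Set.indicator_of_mem hc]
          set a := y (g * c)
          set b := y c
          have e : d * (a ^ 2 + b ^ 2) + 1 / (2 * d) * (a - b) ^ 2 =
            (d / 2 * (a + b) ^ 2 + 1 / (2 * d) * (a - b) ^ 2) + d / 2 * (a - b) ^ 2 := by ring
          have e1 : d / 2 * (a + b) ^ 2 + 1 / (2 * d) * (a - b) ^ 2 - (a ^ 2 - b ^ 2) =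
            (d * (a + b) - (a - b)) ^ 2 / (2 * d) := by field_simp; ring
          have e2 : d / 2 * (a + b) ^ 2 + 1 / (2 * d) * (a - b) ^ 2 + (a ^ 2 - b ^ 2) =
            (d * (a + b) + (a - b)) ^ 2 / (2 * d) := by field_simp; ring
          have p1 : 0 ≤ (d * (a + b) - (a - b)) ^ 2 / (2 * d) := by positivity
          have p2 : 0 ≤ (d * (a + b) + (a - b)) ^ 2 / (2 * d) := by positivity
          have p3 : 0 ≤ d / 2 * (a - b) ^ 2 := by positivity
          rw [abs_le]
          constructor <;> linarith
        · simpa [Set.indicator_of_notMem hc] using hpos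
      have s1 : Summable fun c => y (g * c) ^ 2 := hfs _ fun c _ h => by simp [h]
      have s2 : Summable fun c => y c ^ 2 := hfs _ fun c h _ => by simp [h]
      have s3 : Summable fun c => (y (g * c) - y c) ^ 2 := hfs _ fun c h h' => by simp [h, h']
      have s1' : Summable (A.indicator fun c => y (g * c) ^ 2) := s1.indicator A
      have s2' : Summable (A.indicator fun c => y c ^ 2) := s2.indicator A
      rw [hm']
      have : m p A = ∑' c, A.indicator (fun c => y c ^ 2) c := rfl
      rw [this, ← s1'.tsum_sub s2']
      have hmain := (((s1.add s2).mul_left d).add (s3.mul_left (1 / (2 * d))))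
      calc |∑' c, (A.indicator (fun c => y (g * c) ^ 2) c - A.indicator (fun c => y c ^ 2) c)|
          ≤ ∑' c, |A.indicator (fun c => y (g * c) ^ 2) c - A.indicator (fun c => y c ^ 2) c| := by
            simpa [Real.norm_eq_abs] using norm_tsum_le_tsum_norm (s1'.sub s2').norm
        _ ≤ ∑' c, (d * (y (g * c) ^ 2 + y c ^ 2) + 1 / (2 * d) * (y (g * c) - y c) ^ 2) :=
            (s1'.sub s2').abs.tsum_le_tsum hptw hmain
        _ = d * (1 + 1) + 1 / (2 * d) * ∑' c, (y (g * c) - y c) ^ 2 := by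
            rw [((s1.add s2).mul_left d).tsum_add (s3.mul_left _), tsum_mul_left, tsum_mul_left,
              s1.tsum_add s2, hN, hN']
        _ ≤ d * (1 + 1) + 1 / (2 * d) * d ^ 2 := by gcongr
        _ = 5 / 2 * d := by field_simp; ring
    have hz : Filter.Tendsto (fun p : Finset C × ℕ => 5 / 2 * δ p.2) F (nhds 0) := by
      have h1 : Filter.Tendsto δ Filter.atTop (nhds 0) := tendsto_one_div_add_atTop_nhds_zero_nat
      have h2 : Filter.Tendsto (fun p : Finset C × ℕ => p.2) F Filter.atTop := by
        refine Filter.Tendsto.mono_left ?_ (Ultrafilter.of_le _)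
        rw [← Filter.prod_atTop_atTop_eq]
        exact Filter.tendsto_snd
      simpa using (h1.comp h2).const_mul (5 / 2)
    have hdiff := ((hM ((g * ·) '' A)).sub (hM A)).abs
    have := le_of_tendsto_of_tendsto hdiff hz key
    have h0 : |M ((g * ·) '' A) - M A| = 0 := le_antisymm this (abs_nonneg _)
    linarith [abs_eq_zero.1 h0]

/-- Spectral gap of the regular representation of a nonamenable group, on finitely supported
functions. -/
lemma exists_gap_of_not_isAmenable (C : Type) [Group C] (h : ¬ IsAmenable C) :
    ∃ (K : Finset C) (ε : ℝ), 0 < ε ∧ ∀ x : C →₀ ℝ,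
      ε * ∑' c, x c ^ 2 ≤ ∑ k ∈ K, ∑' c, (x (k * c) - x c) ^ 2 := by
  by_contra hcon
  push Not at hcon
  refine h (isAmenable_of_almost_invariant C fun K δ hδ => ?_)
  obtain ⟨x, hx⟩ := hcon K (δ ^ 2) (by positivity)
  have h0 : ∀ k : C, 0 ≤ ∑' c, (x (k * c) - x c) ^ 2 := fun k => tsum_nonneg fun _ => sq_nonneg _
  have hpos : 0 < ∑' c, x c ^ 2 := by
    have := (Finset.sum_nonneg fun k (_ : k ∈ K) => h0 k).trans_lt hx
    exact pos_of_mul_pos_right this (by positivity)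
  set N := ∑' c, x c ^ 2 with hN
  refine ⟨(Real.sqrt N)⁻¹ • x, ?_, fun k hk => ?_⟩
  · simp only [Finsupp.smul_apply, smul_eq_mul, mul_pow, tsum_mul_left, inv_pow,
      Real.sq_sqrt hpos.le]
    rw [← hN]; field_simp
  · simp only [Finsupp.smul_apply, smul_eq_mul, ← mul_sub, mul_pow, tsum_mul_left, inv_pow,
      Real.sq_sqrt hpos.le]
    have h1 := Finset.single_le_sum (fun k _ => h0 k) hk
    rw [inv_mul_le_iff₀ hpos]
    linarith

lemma sq_sum_le_card_mul_sum_sq_sub {ι : Type*} (K : Finset ι) (i : ι) (hi : i ∈ K) (y : ι → ℝ) :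
    (∑ k ∈ K, y k) ^ 2 ≤ K.card * ∑ k ∈ K, y k ^ 2 - ∑ k ∈ K, (y k - y i) ^ 2 := by
  classical
  set z : ι → ℝ := fun k => y k - y i with hz
  have hy : ∀ k, y k = y i + z k := fun k => by simp [hz]
  have h1 : ∑ k ∈ K, y k = K.card * y i + ∑ k ∈ K, z k := by
    rw [Finset.sum_congr rfl fun k _ => hy k, Finset.sum_add_distrib]; simp
  have h2 : ∑ k ∈ K, y k ^ 2 = K.card * y i ^ 2 + 2 * y i * ∑ k ∈ K, z k + ∑ k ∈ K, z k ^ 2 := by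
    rw [Finset.sum_congr rfl fun k _ => by rw [hy k, add_sq], Finset.sum_add_distrib,
      Finset.sum_add_distrib, ← Finset.mul_sum]; simp
  have h3 : (∑ k ∈ K, z k) ^ 2 ≤ ((K.card : ℝ) - 1) * ∑ k ∈ K, z k ^ 2 := by
    have e1 : ∑ k ∈ K, z k = ∑ k ∈ K.erase i, z k := by
      rw [← Finset.add_sum_erase K z hi]; simp [hz]
    have e2 : ∑ k ∈ K, z k ^ 2 = ∑ k ∈ K.erase i, z k ^ 2 := by
      rw [← Finset.add_sum_erase K (fun k => z k ^ 2) hi]; simp [hz]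
    have e3 : ((K.card : ℝ) - 1) = ((K.erase i).card : ℝ) := by
      rw [Finset.card_erase_of_mem hi, Nat.cast_sub (Finset.card_pos.2 ⟨i, hi⟩)]; simp
    rw [e1, e2, e3]
    exact sq_sum_le_card_mul_sum_sq
  rw [h1, h2]
  nlinarith

lemma summable_finsupp_sq {C : Type*} (x : C →₀ ℝ) : Summable fun c => x c ^ 2 :=
  summable_of_hasFiniteSupport (x.hasFiniteSupport.subset fun c hc => by
    simp only [Function.mem_support] at hc ⊢; exact fun h => hc (by simp [h]))

/-- Norm bound for the averaging operator on the left regular representation. -/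
lemma exists_norm_bound_of_not_isAmenable (C : Type) [Group C] (h : ¬ IsAmenable C) :
    ∃ (K : Finset C) (ρ : ℝ), 0 ≤ ρ ∧ ρ < K.card ∧ (∀ k ∈ K, k⁻¹ ∈ K) ∧ ∀ x : C →₀ ℝ,
      ∑' c, (∑ k ∈ K, x (k⁻¹ * c)) ^ 2 ≤ ρ ^ 2 * ∑' c, x c ^ 2 := by
  classical
  obtain ⟨K₀, ε, hε, hgap⟩ := exists_gap_of_not_isAmenable C h
  set K : Finset C := insert 1 (K₀ ∪ K₀.image (·⁻¹)) with hK
  have hsub : K₀ ⊆ K := fun k hk => by simp [hK, hk]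
  have h1K : (1 : C) ∈ K := by simp [hK]
  have hKinv : ∀ k ∈ K, k⁻¹ ∈ K := by
    intro k hk
    simp only [hK, Finset.mem_insert, Finset.mem_union, Finset.mem_image] at hk ⊢
    rcases hk with rfl | hk | ⟨l, hl, rfl⟩
    · simp
    · exact Or.inr (Or.inr ⟨k, hk, rfl⟩)
    · simp [hl]
  have hshift : ∀ (x : C →₀ ℝ) (k : C), Summable fun c => x (k * c) ^ 2 := fun x k =>
    (Equiv.mulLeft k).summable_iff.2 (summable_finsupp_sq x)
  have hshift' : ∀ (x : C →₀ ℝ) (k : C), ∑' c, x (k * c) ^ 2 = ∑' c, x c ^ 2 := fun x k =>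
    (Equiv.mulLeft k).tsum_eq (fun c => x c ^ 2)
  have hdiff : ∀ (x : C →₀ ℝ) (k : C), Summable fun c => (x (k * c) - x c) ^ 2 := by
    intro x k
    refine Summable.of_nonneg_of_le (fun _ => sq_nonneg _) (fun c => ?_)
      (((hshift x k).mul_left 2).add ((summable_finsupp_sq x).mul_left 2))
    nlinarith [sq_nonneg (x (k * c) + x c)]
  have key : ∀ x : C →₀ ℝ, ∑' c, (∑ k ∈ K, x (k⁻¹ * c)) ^ 2 ≤
      ((K.card : ℝ) ^ 2 - ε) * ∑' c, x c ^ 2 := by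
    intro x
    have hg : ε * ∑' c, x c ^ 2 ≤ ∑ k ∈ K, ∑' c, (x (k⁻¹ * c) - x c) ^ 2 := by
      refine (hgap x).trans ?_
      refine (Finset.sum_le_sum_of_subset_of_nonneg hsub fun k _ _ =>
        tsum_nonneg fun _ => sq_nonneg _).trans (le_of_eq ?_)
      exact Finset.sum_bij (fun k _ => k⁻¹) (fun k hk => hKinv k hk) (by simp)
        (fun k hk => ⟨k⁻¹, hKinv k hk, by simp⟩) (by simp)
    have hpt : ∀ c, (∑ k ∈ K, x (k⁻¹ * c)) ^ 2 ≤ K.card * ∑ k ∈ K, x (k⁻¹ * c) ^ 2 -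
        ∑ k ∈ K, (x (k⁻¹ * c) - x c) ^ 2 := fun c => by
      simpa using sq_sum_le_card_mul_sum_sq_sub K 1 h1K fun k => x (k⁻¹ * c)
    have s1 : Summable fun c => (K.card : ℝ) * ∑ k ∈ K, x (k⁻¹ * c) ^ 2 :=
      (summable_sum fun k _ => hshift x k⁻¹).mul_left _
    have s2 : Summable fun c => ∑ k ∈ K, (x (k⁻¹ * c) - x c) ^ 2 :=
      summable_sum fun k _ => hdiff x k⁻¹
    have s3 : Summable fun c => (∑ k ∈ K, x (k⁻¹ * c)) ^ 2 :=
      Summable.of_nonneg_of_le (fun _ => sq_nonneg _) hpt (s1.sub s2)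
    have := s3.tsum_le_tsum hpt (s1.sub s2)
    rw [s1.tsum_sub s2, tsum_mul_left, Summable.tsum_finsetSum fun k _ => hshift x k⁻¹,
      Summable.tsum_finsetSum fun k _ => hdiff x k⁻¹, Finset.sum_congr rfl fun k _ => hshift' x k⁻¹]
      at this
    simp only [Finset.sum_const, nsmul_eq_mul] at this
    nlinarith
  have hnn : 0 ≤ (K.card : ℝ) ^ 2 - ε := by
    have h0 := key (Finsupp.single 1 1)
    have h2 : ∑' c, (Finsupp.single (1 : C) (1 : ℝ)) c ^ 2 = 1 := by
      rw [tsum_eq_single 1 fun c hc => by simp [hc]]; simp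
    rw [h2, mul_one] at h0
    exact (tsum_nonneg fun _ => sq_nonneg _).trans h0
  refine ⟨K, Real.sqrt ((K.card : ℝ) ^ 2 - ε), Real.sqrt_nonneg _, ?_, hKinv, fun x => ?_⟩
  · refine (Real.sqrt_lt_sqrt hnn (sub_lt_self _ hε)).trans_eq ?_
    exact Real.sqrt_sq (Nat.cast_nonneg _)
  · rw [Real.sq_sqrt hnn]; exact key x

lemma le_mul_of_log_convex_of_le_pow (a : ℕ → ℝ) (ha : ∀ m, 0 ≤ a m)
    (hconv : ∀ m, a (m + 1) ^ 2 ≤ a (m + 2) * a m) (M ρ : ℝ) (hρ : 0 ≤ ρ)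
    (hb : ∀ m, a m ^ 2 ≤ M * (ρ ^ 2) ^ m) : a 1 ≤ ρ * a 0 := by
  by_contra hlt
  push Not at hlt
  have h0 : 0 < a 0 := by
    rcases (ha 0).lt_or_eq with h | h
    · exact h
    · have h1 : a 1 ^ 2 ≤ 0 := by have := hconv 0; simp only [← h] at this; simpa using this
      rw [← h] at hlt
      nlinarith [ha 1]
  set r := a 1 / a 0 with hr
  have hrρ : ρ < r := by rwa [hr, lt_div_iff₀ h0]
  have hrpos : 0 < r := hρ.trans_lt hrρ
  have hstep : ∀ m, 0 < a m ∧ r * a m ≤ a (m + 1) := by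
    intro m
    induction m with
    | zero => exact ⟨h0, by rw [hr]; field_simp; exact le_rfl⟩
    | succ m ih =>
      have hp : 0 < a (m + 1) := (mul_pos hrpos ih.1).trans_le ih.2
      refine ⟨hp, ?_⟩
      have h2 := hconv m
      have h3 : r * a (m + 1) * a m ≤ a (m + 2) * a m := by nlinarith
      exact le_of_mul_le_mul_right h3 ih.1
  have hpow : ∀ m, r ^ m * a 0 ≤ a m := by
    intro m
    induction m with
    | zero => simp
    | succ m ih =>
      calc r ^ (m + 1) * a 0 = r * (r ^ m * a 0) := by ring
        _ ≤ r * a m := by gcongr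
        _ ≤ _ := (hstep m).2
  have hM : ∀ m, a 0 ^ 2 ≤ M * ((ρ / r) ^ 2) ^ m := by
    intro m
    have h1 : (r ^ m * a 0) ^ 2 ≤ M * (ρ ^ 2) ^ m :=
      (pow_le_pow_left₀ (by positivity) (hpow m) 2).trans (hb m)
    have h2 : ((ρ / r) ^ 2) ^ m = (ρ ^ 2) ^ m / (r ^ 2) ^ m := by
      rw [div_pow, div_pow]
    rw [h2, ← mul_div_assoc, le_div_iff₀ (by positivity)]
    calc _ = (r ^ m * a 0) ^ 2 := by ring
      _ ≤ _ := h1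
  have hlim : Filter.Tendsto (fun m : ℕ => M * ((ρ / r) ^ 2) ^ m) Filter.atTop (nhds (M * 0)) := by
    refine (tendsto_pow_atTop_nhds_zero_of_lt_one (by positivity) ?_).const_mul M
    have : ρ / r < 1 := by rwa [div_lt_one hrpos]
    exact pow_lt_one₀ (by positivity) this two_ne_zero
  have := ge_of_tendsto' hlim hM
  nlinarith

/-- Uniform spectral gap for unitary representations of a nonamenable group, on vectors that are
limits of vectors with finitely supported matrix coefficients. -/
lemma exists_uniform_gap (C : Type) [Group C] (h : ¬ IsAmenable C) :
    ∃ (K : Finset C) (κ : ℝ), 0 < κ ∧ ∀ (V : Type) [NormedAddCommGroup V] [InnerProductSpace ℝ V]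
      (π : C → V →ₗᵢ[ℝ] V), (∀ v, π 1 v = v) → (∀ c c' v, π (c * c') v = π c (π c' v)) →
      ∀ v : V, (∀ ε > 0, ∃ d : V, ‖v - d‖ ≤ ε ∧ {c | inner ℝ (π c d) d ≠ 0}.Finite) →
        κ * ‖v‖ ≤ ∑ k ∈ K, ‖π k v - v‖ := by
  classical
  obtain ⟨K, ρ, hρ0, hρ, hKinv, hN⟩ := exists_norm_bound_of_not_isAmenable C h
  refine ⟨K, K.card - ρ, sub_pos.2 hρ, fun V _ _ π hπ1 hπm v hv => ?_⟩
  have key : ∀ d : V, {c | inner ℝ (π c d) d ≠ 0}.Finite →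
      (K.card - ρ) * ‖d‖ ≤ ∑ k ∈ K, ‖π k d - d‖ := by
    intro d hd
    let T : V →ₗ[ℝ] V := ∑ k ∈ K, (π k).toLinearMap
    have hT : ∀ v, T v = ∑ k ∈ K, π k v := fun v => by simp [T]
    have hadj : ∀ k u v, inner ℝ (π k u) v = inner ℝ u (π k⁻¹ v) := by
      intro k u v
      rw [← (π k).inner_map_map u, ← hπm, mul_inv_cancel, hπ1]
    have hsymm : ∀ u v, inner ℝ (T u) v = inner ℝ u (T v) := by
      intro u v
      rw [hT, hT, sum_inner, inner_sum]
      rw [Finset.sum_congr rfl fun k _ => hadj k u v]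
      exact Finset.sum_bij (fun k _ => k⁻¹) (fun k hk => hKinv k hk) (by simp)
        (fun k hk => ⟨k⁻¹, hKinv k hk, by simp⟩) (by simp)
    let L : (C →₀ ℝ) →ₗ[ℝ] V := Finsupp.linearCombination ℝ fun c => π c d
    let S : (C →₀ ℝ) → (C →₀ ℝ) := fun x => ∑ k ∈ K, Finsupp.mapDomain (k * ·) x
    have hS : ∀ x c, S x c = ∑ k ∈ K, x (k⁻¹ * c) := by
      intro x c
      simp only [S, Finsupp.coe_finsetSum, Finset.sum_apply]
      refine Finset.sum_congr rfl fun k _ => ?_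
      conv_lhs => rw [show c = k * (k⁻¹ * c) by simp]
      exact Finsupp.mapDomain_apply (mul_right_injective k) x _
    have hLS : ∀ x, L (S x) = T (L x) := by
      intro x
      simp only [S, map_sum, hT]
      refine Finset.sum_congr rfl fun k _ => ?_
      simp only [L]
      rw [Finsupp.linearCombination_mapDomain]
      simp only [Finsupp.linearCombination_apply, Finsupp.sum, map_sum, map_smul, Function.comp,
        hπm]
    let x : ℕ → (C →₀ ℝ) := fun m => S^[m] (Finsupp.single 1 1)
    have hxs : ∀ m, x (m + 1) = S (x m) := fun m => Function.iterate_succ_apply' _ _ _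
    have hxN : ∀ m, ∑' c, x m c ^ 2 ≤ (ρ ^ 2) ^ m := by
      intro m
      induction m with
      | zero =>
        rw [tsum_eq_single 1 fun c hc => by simp [x, hc]]; simp [x]
      | succ m ih =>
        rw [hxs]
        simp only [hS]
        refine (hN (x m)).trans ?_
        rw [pow_succ' (ρ ^ 2)]
        exact mul_le_mul_of_nonneg_left ih (sq_nonneg ρ)
    let w : ℕ → V := fun m => (T ^ m) d
    have hw0 : w 0 = d := by simp [w]
    have hws : ∀ m, w (m + 1) = T (w m) := fun m => by simp [w, pow_succ']
    have hwL : ∀ m, w m = L (x m) := by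
      intro m
      induction m with
      | zero => simp [hw0, x, L, hπ1]
      | succ m ih => rw [hws, hxs, hLS, ih]
    have hwin : ∀ n m, inner ℝ (w (m + n)) d = inner ℝ (w m) (w n) := by
      intro n
      induction n with
      | zero => intro m; simp [hw0]
      | succ n ih =>
        intro m
        have := ih (m + 1)
        rw [show m + 1 + n = m + (n + 1) by ring] at this
        rw [this, hws, hws, hsymm]
    have hxc : ∀ m c, |x (m + m) c| ≤ (ρ ^ 2) ^ m := by
      intro m c
      have h1 : x (m + m) c ^ 2 ≤ (ρ ^ 2) ^ (m + m) :=
        ((summable_finsupp_sq (x (m + m))).le_tsum c fun _ _ => sq_nonneg _).trans (hxN _)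
      rw [pow_add, ← sq] at h1
      exact abs_le_of_sq_le_sq h1 (by positivity)
    have hbound : ∀ m, ‖w m‖ ^ 2 ≤ (∑ c ∈ hd.toFinset, ‖d‖ * ‖d‖) * (ρ ^ 2) ^ m := by
      intro m
      rw [← real_inner_self_eq_norm_sq, ← hwin m m, hwL]
      simp only [L, Finsupp.linearCombination_apply, Finsupp.sum, sum_inner, inner_smul_left]
      rw [Finset.sum_mul]
      have : ∑ c ∈ (x (m + m)).support, (starRingEnd ℝ) (x (m + m) c) * inner ℝ (π c d) d =
          ∑ c ∈ hd.toFinset, x (m + m) c * inner ℝ (π c d) d := by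
        simp only [conj_trivial]
        rw [Finset.sum_subset (Finset.subset_union_left (s₂ := hd.toFinset)),
          Finset.sum_subset (Finset.subset_union_right (s₁ := (x (m + m)).support)
            (s₂ := hd.toFinset))]
        · intro c _ hc
          have : inner ℝ (π c d) d = 0 := by simpa using hc
          simp [this]
        · intro c _ hc
          have : x (m + m) c = 0 := by simpa using hc
          simp [this]
      rw [this]
      refine Finset.sum_le_sum fun c _ => ?_
      calc x (m + m) c * inner ℝ (π c d) d ≤ |x (m + m) c * inner ℝ (π c d) d| := le_abs_self _
        _ = |x (m + m) c| * |inner ℝ (π c d) d| := abs_mul _ _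
        _ ≤ (ρ ^ 2) ^ m * (‖d‖ * ‖d‖) := by
          gcongr
          · exact hxc m c
          · simpa using abs_real_inner_le_norm (π c d) d
        _ = _ := by ring
    have hT1 : ‖w 1‖ ≤ ρ * ‖w 0‖ := by
      refine le_mul_of_log_convex_of_le_pow (fun m => ‖w m‖) (fun _ => norm_nonneg _) (fun m => ?_)
        _ ρ hρ0 hbound
      rw [← real_inner_self_eq_norm_sq, ← hwin, show m + 1 + (m + 1) = m + 2 + m by ring, hwin]
      exact real_inner_le_norm _ _
    rw [hw0, hws, hw0, hT] at hT1
    have h1 : (K.card : ℝ) * ‖d‖ ≤ ‖∑ k ∈ K, π k d‖ + ∑ k ∈ K, ‖π k d - d‖ := by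
      have : (K.card : ℝ) • d = ∑ k ∈ K, π k d - ∑ k ∈ K, (π k d - d) := by
        rw [Finset.sum_sub_distrib]; simp [Nat.cast_smul_eq_nsmul]
      calc (K.card : ℝ) * ‖d‖ = ‖(K.card : ℝ) • d‖ := by rw [norm_smul]; simp
        _ ≤ ‖∑ k ∈ K, π k d‖ + ‖∑ k ∈ K, (π k d - d)‖ := by rw [this]; exact norm_sub_le _ _
        _ ≤ _ := by gcongr; exact norm_sum_le _ _
    linarith
  have hcard : (0 : ℝ) ≤ K.card := Nat.cast_nonneg _
  refine le_of_forall_pos_le_add fun ε hε => ?_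
  obtain ⟨d, hd, hfin⟩ := hv (ε / (3 * K.card + 1)) (by positivity)
  have h1 := key d hfin
  set δ := ε / (3 * K.card + 1) with hδ
  have hδ' : δ * (3 * K.card + 1) = ε := by rw [hδ]; field_simp
  have hδ0 : 0 < δ := by positivity
  have h2 : ‖v‖ ≤ ‖d‖ + δ := by
    calc ‖v‖ = ‖d + (v - d)‖ := by congr 1; abel
      _ ≤ _ := (norm_add_le _ _).trans (by gcongr)
  have h3 : ∑ k ∈ K, ‖π k d - d‖ ≤ ∑ k ∈ K, ‖π k v - v‖ + K.card * (2 * δ) := by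
    rw [← nsmul_eq_mul, ← Finset.sum_const, ← Finset.sum_add_distrib]
    refine Finset.sum_le_sum fun k _ => ?_
    have e : π k d - d = (π k v - v) + (-π k (v - d) + (v - d)) := by rw [map_sub]; abel
    rw [e]
    refine (norm_add_le _ _).trans ?_
    gcongr
    refine (norm_add_le _ _).trans ?_
    rw [norm_neg, (π k).norm_map]
    linarith
  nlinarith [mul_nonneg hρ0 hδ0.le]

/- ## Product measures and Bernoulli shifts -/

/-- The product measure on `G → Ω` with base `m`. -/
noncomputable abbrev bern (G : Type) {Ω : Type} [MeasurableSpace Ω] (m : Measure Ω)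
    [IsProbabilityMeasure m] : Measure (G → Ω) :=
  Measure.infinitePi fun _ : G => m

section Bernoulli

lemma bernoulli_smul_apply {G Ω : Type} [Group G] (g h : G) (z : G → Ω) :
    (g • z) h = z (g⁻¹ * h) := rfl

variable {G : Type} [Group G] {Ω Ω' : Type} [MeasurableSpace Ω] [MeasurableSpace Ω']
  {m : Measure Ω} [IsProbabilityMeasure m] {m' : Measure Ω'} [IsProbabilityMeasure m']

lemma measurable_bernoulli_smul (g : G) : Measurable fun z : G → Ω => g • z :=
  measurable_pi_iff.2 fun h => measurable_pi_apply (g⁻¹ * h)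

lemma measurePreserving_bernoulli_smul (g : G) :
    MeasurePreserving (fun z : G → Ω => g • z) (bern G m) (bern G m) :=
  ⟨measurable_bernoulli_smul g,
    Measure.map_infinitePi_infinitePi_of_inj (P := fun _ : G => m) (mul_right_injective g⁻¹)⟩

lemma measurePreserving_bernoulli_coord (f : G → Ω → Ω') (hf : ∀ g, MeasurePreserving (f g) m m') :
    MeasurePreserving (fun (z : G → Ω) g => f g (z g)) (bern G m) (bern G m') := by
  refine ⟨measurable_pi_iff.2 fun g => (hf g).measurable.comp (measurable_pi_apply g), ?_⟩
  have := Measure.infinitePi_map_pi (μ := fun _ : G => m) (f := f) fun g => (hf g).measurable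
  rw [this]
  congr 1
  funext g
  exact (hf g).map_eq

lemma exists_cylinder_approx (E : Set (G → Ω)) (hE : MeasurableSet E) (ε : ℝ) (hε : 0 < ε) :
    ∃ (F : Finset G) (S : Set (F → Ω)), MeasurableSet S ∧
      (bern G m).real (E ∆ (F.restrict ⁻¹' S)) < ε := by
  have hd := Measure.MeasureDense.of_generateFrom_isSetAlgebra_finite (μ := bern G m)
    isSetAlgebra_measurableCylinders generateFrom_measurableCylinders.symm
  obtain ⟨t, ht, hlt⟩ := hd.approx E hE (measure_ne_top _ _) ε hε
  obtain ⟨F, S, hS, rfl⟩ := (mem_measurableCylinders t).1 ht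
  exact ⟨F, S, hS, (ENNReal.lt_ofReal_iff_toReal_lt (measure_ne_top _ _)).1 hlt⟩

/-- Measurable maps to a countable set are approximated by maps depending on finitely many
coordinates. -/
lemma exists_local_approx {H : Type} [Countable H] (u : (G → Ω) → H)
    (hu : ∀ h, MeasurableSet {z | u z = h}) (ε : ℝ) (hε : 0 < ε) :
    ∃ (F : Finset G) (v : (G → Ω) → H), (∀ h, MeasurableSet {z | v z = h}) ∧
      (∀ z z', (∀ g ∈ F, z g = z' g) → v z = v z') ∧ (bern G m).real {z | u z ≠ v z} ≤ ε := by
  classical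
  obtain ⟨z0⟩ : Nonempty (G → Ω) := (bern G m).nonempty_of_neZero
  have step : ∀ (S : Finset H) (ε : ℝ), 0 < ε →
      ∃ (F : Finset G) (v : (G → Ω) → H), (∀ h, MeasurableSet {z | v z = h}) ∧
      (∀ z z', (∀ g ∈ F, z g = z' g) → v z = v z') ∧
        (bern G m).real {z | u z ≠ v z ∧ u z ∈ S} ≤ ε := by
    intro S
    induction S using Finset.induction_on with
    | empty =>
      intro ε hε
      exact ⟨∅, fun _ => u z0, fun h => MeasurableSet.const _, fun _ _ _ => rfl, by simp [hε.le]⟩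
    | insert h S hS ih =>
      intro ε hε
      obtain ⟨F, v, hv, hloc, hlt⟩ := ih (ε / 2) (by positivity)
      obtain ⟨F', D, hD, hDlt⟩ := exists_cylinder_approx (m := m) _ (hu h) (ε / 2) (by positivity)
      have hDm : MeasurableSet (F'.restrict ⁻¹' D : Set (G → Ω)) :=
        hD.preimage (Finset.measurable_restrict F')
      refine ⟨F ∪ F', fun z => if z ∈ (F'.restrict ⁻¹' D : Set (G → Ω)) then h else v z,
        fun h' => ?_, fun z z' hz => ?_, ?_⟩
      · have : {z | (if z ∈ (F'.restrict ⁻¹' D : Set (G → Ω)) then h else v z) = h'} =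
            ((F'.restrict ⁻¹' D) ∩ {_z | h = h'}) ∪ ((F'.restrict ⁻¹' D)ᶜ ∩ {z | v z = h'}) := by
          ext z
          by_cases hz : z ∈ (F'.restrict ⁻¹' D : Set (G → Ω))
          · simp only [Set.mem_ofPred_eq, hz, if_true, Set.mem_union, Set.mem_inter_iff, true_and,
              Set.mem_compl_iff, not_true, false_and, or_false]
          · simp only [Set.mem_ofPred_eq, hz, if_false, Set.mem_union, Set.mem_inter_iff, false_and,
              Set.mem_compl_iff, not_false_eq_true, true_and, false_or]
        rw [this]
        exact (hDm.inter (MeasurableSet.const _)).union (hDm.compl.inter (hv h'))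
      · have e1 : F'.restrict z = F'.restrict z' :=
          funext fun g => hz g (Finset.mem_union_right _ g.2)
        have e2 : v z = v z' := hloc z z' fun g hg => hz g (Finset.mem_union_left _ hg)
        simp only [Set.mem_preimage, e1, e2]
      · have hsub : {z | u z ≠ (if z ∈ (F'.restrict ⁻¹' D : Set (G → Ω)) then h else v z) ∧
            u z ∈ insert h S} ⊆
            ({z | u z = h} ∆ (F'.restrict ⁻¹' D)) ∪ {z | u z ≠ v z ∧ u z ∈ S} := by
          rintro z ⟨h1, h2⟩
          by_cases hz : z ∈ (F'.restrict ⁻¹' D : Set (G → Ω))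
          · simp only [hz, if_true] at h1
            exact Or.inl (Or.inr ⟨hz, h1⟩)
          · simp only [hz, if_false] at h1
            rcases Finset.mem_insert.1 h2 with h2 | h2
            · exact Or.inl (Or.inl ⟨h2, hz⟩)
            · exact Or.inr ⟨h1, h2⟩
        refine (measureReal_mono hsub).trans ((measureReal_union_le _ _).trans ?_)
        linarith
  have htail : ∃ S : Finset H, (bern G m).real {z | u z ∉ S} ≤ ε / 2 := by
    have hanti : Antitone fun S : Finset H => {z | u z ∉ S} := fun S T hST z hz h => hz (hST h)
    have hmeas : ∀ S : Finset H, NullMeasurableSet {z | u z ∉ S} (bern G m) := fun S => by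
      have : {z | u z ∉ S} = (⋃ h ∈ S, {z | u z = h})ᶜ := by ext z; simp
      rw [this]
      exact (Finset.measurableSet_biUnion S fun h _ => hu h).compl.nullMeasurableSet
    have hlim := tendsto_measure_iInter_atTop hmeas hanti ⟨∅, measure_ne_top _ _⟩
    have hempty : ⋂ S : Finset H, {z | u z ∉ S} = ∅ := by
      ext z
      simp only [Set.mem_iInter, Set.mem_ofPred_eq, Set.mem_empty_iff_false, iff_false, not_forall,
        not_not]
      exact ⟨{u z}, by simp⟩
    rw [hempty, measure_empty] at hlim
    obtain ⟨S, hS⟩ := (hlim.eventually_lt_const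
      (show (0 : ℝ≥0∞) < ENNReal.ofReal (ε / 2) by simpa using hε)).exists
    exact ⟨S, ((ENNReal.lt_ofReal_iff_toReal_lt (measure_ne_top _ _)).1 hS).le⟩
  obtain ⟨S, hS⟩ := htail
  obtain ⟨F, v, hv, hloc, hlt⟩ := step S (ε / 2) (by positivity)
  refine ⟨F, v, hv, hloc, ?_⟩
  have hsub : {z | u z ≠ v z} ⊆ {z | u z ∉ S} ∪ {z | u z ≠ v z ∧ u z ∈ S} := by
    intro z hz
    by_cases h : u z ∈ S
    · exact Or.inr ⟨hz, h⟩
    · exact Or.inl h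
  refine (measureReal_mono hsub).trans ((measureReal_union_le _ _).trans ?_)
  linarith

lemma finite_not_disjoint_smul (F : Finset G) :
    {g : G | ∃ f ∈ F, ∃ f' ∈ F, g * f = f'}.Finite := by
  classical
  refine ((F ×ˢ F).image fun p => p.2 * p.1⁻¹).finite_toSet.subset ?_
  rintro g ⟨f, hf, f', hf', rfl⟩
  simp only [Finset.coe_image, Set.mem_image, Finset.mem_coe, Finset.mem_product]
  exact ⟨(f, g * f), ⟨hf, hf'⟩, by simp⟩

/-- Bernoulli shifts are mixing. -/
lemma bernoulli_mixing (E D : Set (G → Ω)) (hE : MeasurableSet E) (hD : MeasurableSet D) :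
    Filter.Tendsto (fun g : G => (bern G m).real (E ∩ (fun z => g • z) ⁻¹' D)) Filter.cofinite
      (nhds ((bern G m).real E * (bern G m).real D)) := by
  classical
  set P := bern G m with hP
  rw [Metric.tendsto_nhds]
  intro ε hε
  obtain ⟨F₁, S₁, hS₁, h₁⟩ := exists_cylinder_approx (m := m) E hE (ε / 4) (by positivity)
  obtain ⟨F₂, S₂, hS₂, h₂⟩ := exists_cylinder_approx (m := m) D hD (ε / 4) (by positivity)
  set E' : Set (G → Ω) := F₁.restrict ⁻¹' S₁ with hE'
  set D' : Set (G → Ω) := F₂.restrict ⁻¹' S₂ with hD'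
  have hE'm : MeasurableSet E' := hS₁.preimage (Finset.measurable_restrict F₁)
  have hD'm : MeasurableSet D' := hS₂.preimage (Finset.measurable_restrict F₂)
  have hfin := finite_not_disjoint_smul (F₁ ∪ F₂)
  filter_upwards [hfin.compl_mem_cofinite] with g hg
  have hgm := measurePreserving_bernoulli_smul (m := m) g
  have hdisj : Disjoint F₁ (F₂.image (g⁻¹ * ·)) := by
    rw [Finset.disjoint_left]
    intro f hf hf'
    obtain ⟨f', hf'', rfl⟩ := Finset.mem_image.1 hf'
    exact hg ⟨g⁻¹ * f', Finset.mem_union_left _ hf, f', Finset.mem_union_right _ hf'', by simp⟩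
  have hind := ProbabilityTheory.iIndepFun.indepFun_finset F₁ (F₂.image (g⁻¹ * ·)) hdisj
    (ProbabilityTheory.iIndepFun_infinitePi (P := fun _ : G => m) (X := fun _ ω => ω)
      fun _ => measurable_id) fun i => measurable_pi_apply i
  have hprod : P.real (E' ∩ (fun z => g • z) ⁻¹' D') = P.real E' * P.real D' := by
    let r : (F₂.image (g⁻¹ * ·) → Ω) → (F₂ → Ω) :=
      fun y f => y ⟨g⁻¹ * f, Finset.mem_image_of_mem _ f.2⟩
    have hr : Measurable r := measurable_pi_iff.2 fun f => measurable_pi_apply _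
    have := hind.measure_inter_preimage_eq_mul S₁ (r ⁻¹' S₂) hS₁ (hS₂.preimage hr)
    have e : (fun (a : G → Ω) (i : (F₂.image (g⁻¹ * ·) : Finset G)) => a i) ⁻¹' (r ⁻¹' S₂) =
        (fun z => g • z) ⁻¹' D' := rfl
    have e1 : (fun (a : G → Ω) (i : F₁) => a i) ⁻¹' S₁ = E' := rfl
    rw [e, e1, hgm.measure_preimage hD'm.nullMeasurableSet] at this
    simp only [Measure.real]
    rw [← ENNReal.toReal_mul, ← this]
  have a1 : |P.real (E ∩ (fun z => g • z) ⁻¹' D) - P.real (E' ∩ (fun z => g • z) ⁻¹' D')| ≤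
      P.real (E ∆ E') + P.real (D ∆ D') := by
    refine (abs_measureReal_sub_le_measureReal_symmDiff
      (hE.inter (hD.preimage hgm.measurable)).nullMeasurableSet
      (hE'm.inter (hD'm.preimage hgm.measurable)).nullMeasurableSet).trans ?_
    have hsub : (E ∩ (fun z => g • z) ⁻¹' D) ∆ (E' ∩ (fun z => g • z) ⁻¹' D') ⊆
        (E ∆ E') ∪ (fun z => g • z) ⁻¹' (D ∆ D') := by
      intro z
      simp only [Set.mem_symmDiff, Set.mem_union, Set.mem_inter_iff, Set.mem_preimage]
      tauto
    refine (measureReal_mono hsub).trans ((measureReal_union_le _ _).trans ?_)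
    rw [hgm.measureReal_preimage (hD.symmDiff hD'm).nullMeasurableSet]
  have a2 := abs_measureReal_sub_le_measureReal_symmDiff (μ := P) hE.nullMeasurableSet
    hE'm.nullMeasurableSet
  have a3 := abs_measureReal_sub_le_measureReal_symmDiff (μ := P) hD.nullMeasurableSet
    hD'm.nullMeasurableSet
  have b1 : P.real E ≤ 1 := measureReal_le_one
  have b2 : P.real D' ≤ 1 := measureReal_le_one
  have b3 : 0 ≤ P.real E := measureReal_nonneg
  have b4 : 0 ≤ P.real D' := measureReal_nonneg
  rw [Real.dist_eq]
  rw [hprod] at a1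
  have key : |P.real E' * P.real D' - P.real E * P.real D| < ε / 2 := by
    have : P.real E' * P.real D' - P.real E * P.real D =
      -((P.real E - P.real E') * P.real D') - P.real E * (P.real D - P.real D') := by ring
    rw [this]
    refine (abs_sub _ _).trans_lt ?_
    rw [abs_neg, abs_mul, abs_mul, abs_of_nonneg b3, abs_of_nonneg b4]
    have : |P.real E - P.real E'| * P.real D' ≤ |P.real E - P.real E'| :=
      mul_le_of_le_one_right (abs_nonneg _) b2
    have : P.real E * |P.real D - P.real D'| ≤ |P.real D - P.real D'| :=
      mul_le_of_le_one_left (abs_nonneg _) b1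
    linarith
  have := abs_sub_le (P.real (E ∩ (fun z => g • z) ⁻¹' D)) (P.real E' * P.real D')
    (P.real E * P.real D)
  linarith

lemma tendsto_pow_cofinite {s : G} (hs : ¬ IsOfFinOrder s) :
    Filter.Tendsto (fun n : ℕ => s ^ n) Filter.atTop Filter.cofinite := by
  rw [← Nat.cofinite_eq_atTop]
  exact (injective_pow_iff_not_isOfFinOrder.2 hs).tendsto_cofinite

lemma ergodic_bernoulli_smul {s : G} (hs : ¬ IsOfFinOrder s) :
    Ergodic (fun z : G → Ω => s • z) (bern G m) := by
  refine ⟨measurePreserving_bernoulli_smul s, ⟨fun E hE hinv => ?_⟩⟩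
  have hpow : ∀ n : ℕ, (fun z : G → Ω => s ^ n • z) ⁻¹' E = E := by
    intro n
    induction n with
    | zero => simp
    | succ n ih =>
      have : (fun z : G → Ω => s ^ (n + 1) • z) = (fun z => s ^ n • z) ∘ fun z => s • z := by
        funext z; simp [pow_succ, mul_smul]
      rw [this, Set.preimage_comp, ih, hinv]
  have hlim := (bernoulli_mixing (m := m) E E hE hE).comp (tendsto_pow_cofinite hs)
  have hconst : ((fun g : G => (bern G m).real (E ∩ (fun z => g • z) ⁻¹' E)) ∘
      fun n : ℕ => s ^ n) = fun _ => (bern G m).real E := by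
    funext n
    simp [hpow]
  rw [hconst] at hlim
  have heq := tendsto_nhds_unique hlim tendsto_const_nhds
  rw [Filter.eventuallyConst_set']
  have h01 : (bern G m).real E = 0 ∨ (bern G m).real E = 1 := by
    rcases eq_or_ne ((bern G m).real E) 0 with h | h
    · exact Or.inl h
    · refine Or.inr (mul_left_cancel₀ h ?_)
      rw [heq, mul_one]
  rcases h01 with h | h
  · left
    rw [ae_eq_empty]
    exact (measureReal_eq_zero_iff).1 h
  · right
    rw [ae_eq_univ]
    have h1 : (bern G m).real Eᶜ = 0 := by rw [probReal_compl_eq_one_sub hE, h, sub_self]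
    exact (measureReal_eq_zero_iff).1 h1

/-- A product of two product measures is a product measure. -/
lemma measurePreserving_bern_unzip :
    MeasurePreserving (fun z : G → Ω × Ω' => ((fun g => (z g).1), (fun g => (z g).2)))
      (bern G (m.prod m')) ((bern G m).prod (bern G m')) := by
  have hmeas : Measurable (fun z : G → Ω × Ω' => ((fun g => (z g).1), (fun g => (z g).2))) :=
    (measurable_pi_iff.2 fun g => measurable_fst.comp (measurable_pi_apply g)).prodMk
      (measurable_pi_iff.2 fun g => measurable_snd.comp (measurable_pi_apply g))
  refine ⟨hmeas, ?_⟩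
  have hfs : ∀ (α : Type) [MeasurableSpace α] (p : Measure α) [IsProbabilityMeasure p],
      (bern G p).FiniteSpanningSetsIn
        (squareCylinders fun _ : G => {s : Set α | MeasurableSet s}) := fun α _ p _ =>
    { set := fun _ => Set.univ
      set_mem := fun _ => ⟨∅, fun _ => Set.univ, by simp, by simp⟩
      finite := fun _ => measure_lt_top _ _
      spanning := Set.iUnion_const _ }
  symm
  refine Measure.prod_eq_generateFrom generateFrom_squareCylinders generateFrom_squareCylinders
    (isPiSystem_squareCylinders (fun _ => MeasurableSpace.isPiSystem_measurableSet) (by simp))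
    (isPiSystem_squareCylinders (fun _ => MeasurableSpace.isPiSystem_measurableSet) (by simp))
    (hfs Ω m) (hfs Ω' m') ?_
  classical
  rintro _ ⟨F, t, ht, rfl⟩ _ ⟨F', t', ht', rfl⟩
  simp only [Set.mem_univ_pi, Set.mem_ofPred_eq] at ht ht'
  let T : G → Set Ω := fun g => if g ∈ F then t g else Set.univ
  let T' : G → Set Ω' := fun g => if g ∈ F' then t' g else Set.univ
  have hT : ∀ g, MeasurableSet (T g) := fun g => by
    by_cases h : g ∈ F <;> simp [T, h, ht]
  have hT' : ∀ g, MeasurableSet (T' g) := fun g => by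
    by_cases h : g ∈ F' <;> simp [T', h, ht']
  have e1 : (F : Set G).pi t = ((F ∪ F' : Finset G) : Set G).pi T := by
    ext z
    simp only [Set.mem_pi, Finset.mem_coe, Finset.mem_union, T]
    refine ⟨fun h g _ => ?_, fun h g hg => ?_⟩
    · by_cases hg : g ∈ F
      · simp [hg, h g hg]
      · simp [hg]
    · simpa [hg] using h g (Or.inl hg)
  have e2 : (F' : Set G).pi t' = ((F ∪ F' : Finset G) : Set G).pi T' := by
    ext z
    simp only [Set.mem_pi, Finset.mem_coe, Finset.mem_union, T']
    refine ⟨fun h g _ => ?_, fun h g hg => ?_⟩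
    · by_cases hg : g ∈ F'
      · simp [hg, h g hg]
      · simp [hg]
    · simpa [hg] using h g (Or.inr hg)
  rw [e1, e2, Measure.map_apply hmeas ((MeasurableSet.pi (Finset.countable_toSet _)
    fun g _ => hT g).prod (MeasurableSet.pi (Finset.countable_toSet _) fun g _ => hT' g))]
  have e3 : (fun z : G → Ω × Ω' => ((fun g => (z g).1), (fun g => (z g).2))) ⁻¹'
      (((F ∪ F' : Finset G) : Set G).pi T ×ˢ ((F ∪ F' : Finset G) : Set G).pi T') =
      ((F ∪ F' : Finset G) : Set G).pi fun g => T g ×ˢ T' g := by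
    ext z
    simp only [Set.mem_preimage, Set.mem_prod, Set.mem_pi]
    exact ⟨fun h g hg => ⟨h.1 g hg, h.2 g hg⟩, fun h => ⟨fun g hg => (h g hg).1,
      fun g hg => (h g hg).2⟩⟩
  rw [e3, Measure.infinitePi_pi _ fun g _ => (hT g).prod (hT' g),
    Measure.infinitePi_pi _ fun g _ => hT g, Measure.infinitePi_pi _ fun g _ => hT' g,
    ← Finset.prod_mul_distrib]
  exact Finset.prod_congr rfl fun g _ => Measure.prod_prod _ _

/-- The diagonal action of an infinite order element on a product of Bernoulli shifts is
ergodic. -/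
lemma ergodic_bernoulli_smul_prod {s : G} (hs : ¬ IsOfFinOrder s) :
    Ergodic (Prod.map (fun z : G → Ω => s • z) (fun z : G → Ω' => s • z))
      ((bern G m).prod (bern G m')) := by
  have hz := measurePreserving_bern_unzip (G := G) (m := m) (m' := m')
  have he := ergodic_bernoulli_smul (m := m.prod m') hs
  refine ⟨(measurePreserving_bernoulli_smul s).prod (measurePreserving_bernoulli_smul s),
    ⟨fun E hE hinv => ?_⟩⟩
  have h1 := he.aeconst_set (hE.preimage hz.measurable) (by
    rw [← Set.preimage_comp]
    conv_rhs => rw [← hinv, ← Set.preimage_comp]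
    rfl)
  rw [Filter.eventuallyConst_set'] at h1 ⊢
  rw [ae_eq_empty, ae_eq_univ] at h1 ⊢
  rw [← Set.preimage_compl, hz.measure_preimage hE.nullMeasurableSet,
    hz.measure_preimage hE.compl.nullMeasurableSet] at h1
  exact h1

end Bernoulli

/- ## Graphs of maps into a countable group -/

section Graph

variable {Z H : Type} [MeasurableSpace Z] [Countable H] [MeasurableSpace H]
  [DiscreteMeasurableSpace H] {P : Measure Z} [IsProbabilityMeasure P]

/-- The graph of a map. -/
def graphSet (f : Z → H) : Set (Z × H) := {p | f p.1 = p.2}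

lemma measurableSet_graphSet {f : Z → H} (hf : Measurable f) : MeasurableSet (graphSet f) :=
  measurableSet_eq_fun (hf.comp measurable_fst) measurable_snd

lemma measure_graphSet_inter {f g : Z → H} (hf : Measurable f) (hg : Measurable g) :
    (P.prod Measure.count) (graphSet f ∩ graphSet g) = P {z | f z = g z} := by
  rw [Measure.prod_apply ((measurableSet_graphSet hf).inter (measurableSet_graphSet hg)),
    ← lintegral_indicator_one (measurableSet_eq_fun hf hg)]
  refine lintegral_congr fun z => ?_
  by_cases h : f z = g z
  · have : Prod.mk z ⁻¹' (graphSet f ∩ graphSet g) = {f z} := by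
      ext k; simp only [graphSet, Set.mem_preimage, Set.mem_inter_iff, Set.mem_ofPred_eq, ← h,
        and_self, Set.mem_singleton_iff, eq_comm]
    rw [this, Measure.count_singleton, Set.indicator_of_mem (by exact h)]; rfl
  · have : Prod.mk z ⁻¹' (graphSet f ∩ graphSet g) = ∅ := by
      ext k
      simp only [graphSet, Set.mem_preimage, Set.mem_inter_iff, Set.mem_ofPred_eq,
        Set.mem_empty_iff_false, iff_false, not_and]
      exact fun h1 h2 => h (h1.trans h2.symm)
    rw [this, measure_empty, Set.indicator_of_notMem (by exact h)]

lemma measure_graphSet_ne_top {f : Z → H} (hf : Measurable f) :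
    (P.prod Measure.count) (graphSet f) ≠ ∞ := by
  rw [← Set.inter_self (graphSet f), measure_graphSet_inter hf hf]
  exact measure_ne_top _ _

/-- The indicator function of the graph of a map, as an `L²` function. -/
noncomputable def graphVec (P : Measure Z) [IsProbabilityMeasure P] (f : Z → H)
    (hf : Measurable f) : Lp ℝ 2 (P.prod (Measure.count : Measure H)) :=
  indicatorConstLp 2 (measurableSet_graphSet hf) (measure_graphSet_ne_top hf) 1

lemma inner_graphVec {f g : Z → H} (hf : Measurable f) (hg : Measurable g) :
    inner ℝ (graphVec P f hf) (graphVec P g hg) = P.real {z | f z = g z} := by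
  rw [graphVec, graphVec, L2.real_inner_indicatorConstLp_one_indicatorConstLp_one
    (measurableSet_graphSet hf) (measurableSet_graphSet hg) (measure_graphSet_ne_top hf)
    (measure_graphSet_ne_top hg), Measure.real, measure_graphSet_inter hf hg, Measure.real]

lemma norm_sub_graphVec {f g : Z → H} (hf : Measurable f) (hg : Measurable g) :
    ‖graphVec P f hf - graphVec P g hg‖ = Real.sqrt (2 * P.real {z | f z ≠ g z}) := by
  rw [eq_comm, Real.sqrt_eq_iff_mul_self_eq (by positivity) (norm_nonneg _), ← sq,
    @norm_sub_sq_real, ← real_inner_self_eq_norm_sq, ← real_inner_self_eq_norm_sq,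
    inner_graphVec, inner_graphVec, inner_graphVec]
  have : {z | f z ≠ g z} = {z | f z = g z}ᶜ := rfl
  rw [this, probReal_compl_eq_one_sub (measurableSet_eq_fun hf hg)]
  simp only [Set.ofPred_true, probReal_univ]
  ring

variable [Group H]

lemma map_count_mul_mul_inv (a b : H) :
    Measure.map (fun h => a * h * b⁻¹) (Measure.count : Measure H) = Measure.count := by
  refine Measure.ext fun s hs => ?_
  rw [Measure.map_apply Measurable.of_discrete hs]
  have : (fun h => a * h * b⁻¹) ⁻¹' s = (fun h => a⁻¹ * h * b) '' s := by
    ext h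
    simp only [Set.mem_preimage, Set.mem_image]
    exact ⟨fun hh => ⟨_, hh, by group⟩, by rintro ⟨k, hk, rfl⟩; convert hk using 1; group⟩
  rw [this, Measure.count_injective_image fun h h' hh => by simpa using hh]

lemma measurePreserving_skew {T : Z → Z} (hT : MeasurePreserving T P P) {L R : Z → H}
    (hL : Measurable L) (hR : Measurable R) :
    MeasurePreserving (fun p : Z × H => (T p.1, L p.1 * p.2 * (R p.1)⁻¹))
      (P.prod Measure.count) (P.prod Measure.count) :=
  hT.skew_product (g := fun z h => L z * h * (R z)⁻¹)
    (((hL.comp measurable_fst).mul measurable_snd).mul (hR.comp measurable_fst).inv)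
    (Filter.Eventually.of_forall fun _ => map_count_mul_mul_inv _ _)

/-- Spectral gap estimate for maps into a countable group, twisted by a pair of cocycles of a
nonamenable group. -/
lemma twisted_gap (C : Type) [Group C] (hC : ¬ IsAmenable C) :
    ∃ (K : Finset C) (κ : ℝ), 0 < κ ∧ ∀ (Z H : Type) [MeasurableSpace Z] [Group H] [Countable H]
      [MeasurableSpace H] [DiscreteMeasurableSpace H] (P : Measure Z) [IsProbabilityMeasure P]
      (T : C → Z → Z) (L R : C → Z → H), (∀ c, MeasurePreserving (T c) P P) →
      (∀ c, Measurable (L c)) → (∀ c, Measurable (R c)) → (∀ z, T 1 z = z) →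
      (∀ c c' z, T (c * c') z = T c (T c' z)) →
      (∀ c c' z, L (c * c') z = L c (T c' z) * L c' z) →
      (∀ c c' z, R (c * c') z = R c (T c' z) * R c' z) →
      ∀ f₁ f₂ : Z → H, Measurable f₁ → Measurable f₂ →
      (∀ ε > 0, ∃ e₁ e₂ : Z → H, Measurable e₁ ∧ Measurable e₂ ∧ P.real {z | f₁ z ≠ e₁ z} ≤ ε ∧
        P.real {z | f₂ z ≠ e₂ z} ≤ ε ∧
        {c : C | ¬ ∀ e, e = e₁ ∨ e = e₂ → P.real {z | e (T c z) = L c z * e₁ z * (R c z)⁻¹} =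
          P.real {z | e (T c z) = L c z * e₂ z * (R c z)⁻¹}}.Finite) →
      κ * Real.sqrt (2 * P.real {z | f₁ z ≠ f₂ z}) ≤
        ∑ k ∈ K, (Real.sqrt (2 * P.real {z | f₁ (T k z) ≠ L k z * f₁ z * (R k z)⁻¹}) +
          Real.sqrt (2 * P.real {z | f₂ (T k z) ≠ L k z * f₂ z * (R k z)⁻¹})) := by
  obtain ⟨K, κ, hκ, hgap⟩ := exists_uniform_gap C hC
  refine ⟨K.map (Equiv.inv C).toEmbedding, κ, hκ, ?_⟩
  intro Z H _ _ _ _ _ P _ T L R hT hL hR hT1 hTm hLm hRm f₁ f₂ hf₁ hf₂ happ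
  have hL1 : ∀ z, L 1 z = 1 := fun z => by
    have := hLm 1 1 z; rw [hT1, mul_one] at this; exact left_eq_mul.1 this
  have hR1 : ∀ z, R 1 z = 1 := fun z => by
    have := hRm 1 1 z; rw [hT1, mul_one] at this; exact left_eq_mul.1 this
  let τ : C → Z × H → Z × H := fun c p => (T c p.1, L c p.1 * p.2 * (R c p.1)⁻¹)
  have hτ : ∀ c, MeasurePreserving (τ c) (P.prod Measure.count) (P.prod Measure.count) :=
    fun c => measurePreserving_skew (hT c) (hL c) (hR c)
  have hτ1 : τ 1 = id := by
    funext p; simp [τ, hT1, hL1, hR1]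
  have hτm : ∀ c c', τ (c * c') = τ c ∘ τ c' := by
    intro c c'
    funext p
    simp only [τ, Function.comp, hTm, hLm, hRm, Prod.mk.injEq, true_and]
    group
  let π : C → Lp ℝ 2 (P.prod (Measure.count : Measure H)) →ₗᵢ[ℝ]
      Lp ℝ 2 (P.prod (Measure.count : Measure H)) :=
    fun c => Lp.compMeasurePreservingₗᵢ ℝ (τ c⁻¹) (hτ c⁻¹)
  have hπ : ∀ c v, ⇑(π c v) =ᵐ[P.prod Measure.count] v ∘ τ c⁻¹ := fun c v =>
    Lp.coeFn_compMeasurePreserving v (hτ c⁻¹)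
  have hπ1 : ∀ v, π 1 v = v := fun v => by
    refine Lp.ext ((hπ 1 v).trans ?_)
    rw [inv_one, hτ1]; rfl
  have hπm : ∀ c c' v, π (c * c') v = π c (π c' v) := fun c c' v => by
    refine Lp.ext ((hπ _ v).trans ((hπ c _).trans ?_).symm)
    refine ((hτ c⁻¹).quasiMeasurePreserving.ae_eq_comp (hπ c' v)).trans ?_
    rw [mul_inv_rev, hτm]; rfl
  -- the transported map, whose graph is the image of the graph of `f` under `τ c`
  let tr : C → (Z → H) → (Z → H) := fun c f z =>
    (L c⁻¹ z)⁻¹ * f (T c⁻¹ z) * R c⁻¹ z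
  have htr : ∀ c f, Measurable f → Measurable (tr c f) := fun c f hf =>
    ((hL _).inv.mul (hf.comp (hT _).measurable)).mul (hR _)
  have hπtr : ∀ c f (hf : Measurable f), π c (graphVec P f hf) = graphVec P (tr c f) (htr c f hf) := by
    intro c f hf
    refine Lp.ext ((hπ c _).trans ?_)
    refine ((hτ c⁻¹).quasiMeasurePreserving.ae_eq_comp indicatorConstLp_coeFn).trans ?_
    refine Filter.EventuallyEq.trans ?_ indicatorConstLp_coeFn.symm
    refine Filter.Eventually.of_forall fun p => ?_
    have : τ c⁻¹ p ∈ graphSet f ↔ p ∈ graphSet (tr c f) := by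
      simp only [graphSet, Set.mem_ofPred_eq, τ, tr]
      constructor
      · intro h
        rw [h]
        group
      · intro h
        rw [← h]
        group
    by_cases hp : τ c⁻¹ p ∈ graphSet f
    · rw [Function.comp_apply, Set.indicator_of_mem hp, Set.indicator_of_mem (this.1 hp)]
    · rw [Function.comp_apply, Set.indicator_of_notMem hp, Set.indicator_of_notMem (mt this.2 hp)]
  have htreq : ∀ (c : C) (f e : Z → H), {z | tr c f z = e z} = {z | f (T c⁻¹ z) = L c⁻¹ z * e z * (R c⁻¹ z)⁻¹} := by
    intro c f e
    ext z
    simp only [Set.mem_ofPred_eq, tr]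
    rw [mul_assoc (L c⁻¹ z)⁻¹, inv_mul_eq_iff_eq_mul, eq_mul_inv_iff_mul_eq]
  have hmain := hgap _ π hπ1 hπm (graphVec P f₁ hf₁ - graphVec P f₂ hf₂) (fun ε hε => by
    obtain ⟨e₁, e₂, he₁, he₂, h₁, h₂, hfin⟩ := happ (ε ^ 2 / 8) (by positivity)
    refine ⟨graphVec P e₁ he₁ - graphVec P e₂ he₂, ?_, ?_⟩
    · have e : graphVec P f₁ hf₁ - graphVec P f₂ hf₂ - (graphVec P e₁ he₁ - graphVec P e₂ he₂) =
          (graphVec P f₁ hf₁ - graphVec P e₁ he₁) - (graphVec P f₂ hf₂ - graphVec P e₂ he₂) := by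
        abel
      rw [e]
      refine (norm_sub_le _ _).trans ?_
      rw [norm_sub_graphVec, norm_sub_graphVec]
      have : ∀ t : ℝ, t ≤ ε ^ 2 / 8 → Real.sqrt (2 * t) ≤ ε / 2 := fun t ht =>
        Real.sqrt_le_iff.2 ⟨by positivity, by nlinarith⟩
      linarith [this _ h₁, this _ h₂]
    · refine (hfin.preimage (f := fun c : C => c⁻¹) inv_injective.injOn).subset fun c hc => ?_
      simp only [Set.mem_preimage, Set.mem_ofPred_eq] at hc ⊢
      contrapose! hc
      rw [map_sub, hπtr, hπtr, inner_sub_left, inner_sub_right, inner_sub_right, inner_graphVec,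
        inner_graphVec, inner_graphVec, inner_graphVec, htreq, htreq, htreq, htreq,
        hc e₁ (Or.inl rfl), hc e₂ (Or.inr rfl)]
      ring)
  rw [norm_sub_graphVec] at hmain
  refine hmain.trans ?_
  rw [Finset.sum_map]
  refine Finset.sum_le_sum fun k _ => ?_
  have e : π k (graphVec P f₁ hf₁ - graphVec P f₂ hf₂) - (graphVec P f₁ hf₁ - graphVec P f₂ hf₂) =
      (graphVec P (tr k f₁) (htr k f₁ hf₁) - graphVec P f₁ hf₁) -
        (graphVec P (tr k f₂) (htr k f₂ hf₂) - graphVec P f₂ hf₂) := by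
    rw [map_sub, hπtr, hπtr]; abel
  rw [e]
  refine (norm_sub_le _ _).trans (le_of_eq ?_)
  have hne : ∀ (c : C) (f e : Z → H), {z | tr c f z ≠ e z} =
      {z | f (T c⁻¹ z) ≠ L c⁻¹ z * e z * (R c⁻¹ z)⁻¹} := fun c f e =>
    congrArg compl (htreq c f e)
  rw [norm_sub_graphVec, norm_sub_graphVec, hne, hne]
  rfl

end Graph

section Uniform

variable {G : Type} [Group G] {H : Type} [Group H] [Countable H]
  [MeasurableSpace H] [DiscreteMeasurableSpace H] {A : Type} [MeasurableSpace A]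
  [StandardBorelSpace A] {μ₀ : Measure A} [IsProbabilityMeasure μ₀]

/-- A measurable map on a Bernoulli space is almost unchanged by a slight change of the
coordinates. -/
lemma exists_forall_coord_close (u : (G → A) → H) (hu : Measurable u) (ε : ℝ) (hε : 0 < ε) :
    ∃ θ : ℝ, 0 < θ ∧ ∀ (Ω : Type) [MeasurableSpace Ω] (m : Measure Ω) [IsProbabilityMeasure m]
      (X Y : Ω → A), MeasurePreserving X m μ₀ → MeasurePreserving Y m μ₀ →
      m.real {w | Y w ≠ X w} ≤ θ →
      (bern G m).real {z | u (fun g => Y (z g)) ≠ u (fun g => X (z g))} ≤ ε := by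
  obtain ⟨F, v, hv, hloc, hclose⟩ := exists_local_approx (m := μ₀) u
    (fun h => hu (measurableSet_singleton h)) (ε / 4) (by positivity)
  refine ⟨ε / (2 * (F.card + 1)), by positivity, ?_⟩
  intro Ω _ m _ X Y hX hY hm
  have hmeas : MeasurableSet {x : G → A | u x ≠ v x} :=
    (measurableSet_eq_fun hu (measurable_to_countable' hv)).compl
  have key : ∀ W : Ω → A, MeasurePreserving W m μ₀ →
      (bern G m).real {z | u (fun g => W (z g)) ≠ v (fun g => W (z g))} ≤ ε / 4 := fun W hW => by
    refine le_trans (le_of_eq ?_) hclose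
    exact (measurePreserving_bernoulli_coord (G := G) (fun _ => W) fun _ => hW).measureReal_preimage
      hmeas.nullMeasurableSet
  have hmYX : MeasurableSet {w | Y w ≠ X w} :=
    (measurableSet_eq_fun hY.measurable hX.measurable).compl
  have hF : (bern G m).real (⋃ g ∈ F, {z | Y (z g) ≠ X (z g)}) ≤ ε / 2 := by
    refine (measureReal_biUnion_finset_le _ _).trans ?_
    have h1 : ∀ g ∈ F, (bern G m).real {z | Y (z g) ≠ X (z g)} ≤ ε / (2 * (F.card + 1)) :=
      fun g _ => by
        refine le_trans (le_of_eq ?_) hm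
        exact (measurePreserving_eval_infinitePi (fun _ : G => m) g).measureReal_preimage
          hmYX.nullMeasurableSet
    refine (Finset.sum_le_card_nsmul _ _ _ h1).trans ?_
    rw [nsmul_eq_mul, mul_div_assoc', div_le_div_iff₀ (by positivity) (by norm_num)]
    nlinarith
  have hsub : {z : G → Ω | u (fun g => Y (z g)) ≠ u (fun g => X (z g))} ⊆
      ({z | u (fun g => Y (z g)) ≠ v (fun g => Y (z g))} ∪
        {z | u (fun g => X (z g)) ≠ v (fun g => X (z g))}) ∪
          ⋃ g ∈ F, {z | Y (z g) ≠ X (z g)} := by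
    intro z hz
    by_contra hcon
    simp only [Set.mem_union, Set.mem_ofPred_eq, Set.mem_iUnion, not_or, not_not, not_exists] at hcon
    refine hz ?_
    rw [hcon.1.1, hcon.1.2]
    exact hloc _ _ fun g hg => hcon.2 g hg
  refine (measureReal_mono hsub).trans ((measureReal_union_le _ _).trans ?_)
  linarith [measureReal_union_le (μ := bern G m)
    {z : G → Ω | u (fun g => Y (z g)) ≠ v (fun g => Y (z g))}
        {z | u (fun g => X (z g)) ≠ v (fun g => X (z g))}, key Y hY, key X hX]

/-- Uniform stability of the values of a cocycle at the elements centralizing a nonamenable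
subgroup, under a slight change of the coordinates. -/
lemma exists_forall_cocycle_close (C : Subgroup G) (hC : ¬ IsAmenable C) (ω : G → (G → A) → H)
    (hω : ∀ g, Measurable (ω g)) (hcoc : ∀ g h x, ω (g * h) x = ω g (h • x) * ω h x)
    (δ : ℝ) (hδ : 0 < δ) :
    ∃ θ : ℝ, 0 < θ ∧ ∀ (Ω : Type) [MeasurableSpace Ω] (m : Measure Ω) [IsProbabilityMeasure m]
      (X Y₁ Y₂ : Ω → A) (σ : Ω → Ω), MeasurePreserving X m μ₀ → MeasurePreserving Y₁ m μ₀ →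
      MeasurePreserving Y₂ m μ₀ → MeasurePreserving σ m m → (∀ w, X (σ w) = X w) →
      (∀ w, Y₁ (σ w) = Y₂ w) → (∀ w, Y₂ (σ w) = Y₁ w) → m.real {w | Y₁ w ≠ X w} ≤ θ →
      ∀ b : G, (∀ c ∈ C, Commute b c) →
      (bern G m).real {z | ω b (fun g => Y₁ (z g)) ≠ ω b (fun g => Y₂ (z g))} ≤ δ := by
  obtain ⟨K, κ, hκ, hgap⟩ := twisted_gap C hC
  set η : ℝ := (κ * Real.sqrt (2 * δ) / (4 * (K.card + 1))) ^ 2 with hη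
  have hη0 : 0 < η := by positivity
  choose θ hθ hclose using fun k : C =>
    exists_forall_coord_close (μ₀ := μ₀) (ω (k : G)) (hω k) η hη0
  obtain ⟨t, htK, ht⟩ : ∃ t, (∀ k ∈ K, t ≤ θ k) ∧ 0 < t := by
    have h1 : ∀ᶠ t in nhdsWithin (0 : ℝ) (Set.Ioi 0), ∀ k ∈ K, t ≤ θ k := by
      rw [Filter.eventually_all_finset]
      intro k _
      exact nhdsWithin_le_nhds (Iic_mem_nhds (hθ k))
    have h2 : ∀ᶠ t in nhdsWithin (0 : ℝ) (Set.Ioi 0), 0 < t := self_mem_nhdsWithin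
    exact (h1.and h2).exists
  refine ⟨t, ht, ?_⟩
  intro Ω _ m _ X Y₁ Y₂ σ hX hY₁ hY₂ hσ hXσ h12 h21 hm b hb
  have hlift : ∀ W : Ω → A, MeasurePreserving W m μ₀ →
      MeasurePreserving (fun (z : G → Ω) g => W (z g)) (bern G m) (bern G μ₀) := fun W hW =>
    measurePreserving_bernoulli_coord (G := G) (fun _ => W) fun _ => hW
  have hequiv : ∀ (W : Ω → A) (g : G) (z : G → Ω),
      (fun i => W ((g • z) i)) = g • (fun i => W (z i)) := fun _ _ _ => rfl
  have hm₂ : m.real {w | Y₂ w ≠ X w} ≤ t := by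
    refine le_trans (le_of_eq ?_) hm
    have : {w | Y₂ w ≠ X w} = σ ⁻¹' {w | Y₁ w ≠ X w} := by
      ext w; simp only [Set.mem_ofPred_eq, Set.mem_preimage, h12, hXσ]
    rw [this]
    exact hσ.measureReal_preimage
      (measurableSet_eq_fun hY₁.measurable hX.measurable).compl.nullMeasurableSet
  have hbC : ∀ c : C, b * c = c * b := fun c => hb c c.2
  -- almost invariance
  have hdef : ∀ (W : Ω → A), MeasurePreserving W m μ₀ → m.real {w | W w ≠ X w} ≤ t → ∀ k ∈ K,
      (bern G m).real {z | ω b (fun i => W (((k : G) • z) i)) ≠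
        ω k (b • fun i => X (z i)) * ω b (fun i => W (z i)) * (ω k (fun i => X (z i)))⁻¹} ≤
          2 * η := by
    intro W hW hWm k hk
    have h1 := hclose k Ω m X W hX hW (hWm.trans (htK k hk))
    have hmeas : MeasurableSet {z : G → Ω | ω k (fun g => W (z g)) ≠ ω k (fun g => X (z g))} :=
      (measurableSet_eq_fun ((hω k).comp (hlift W hW).measurable)
        ((hω k).comp (hlift X hX).measurable)).compl
    have h2 := (measurePreserving_bernoulli_smul (m := m) b).measureReal_preimage
      hmeas.nullMeasurableSet
    have hsub : {z : G → Ω | ω b (fun i => W (((k : G) • z) i)) ≠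
        ω k (b • fun i => X (z i)) * ω b (fun i => W (z i)) * (ω k (fun i => X (z i)))⁻¹} ⊆
        ((fun z : G → Ω => b • z) ⁻¹'
          {z : G → Ω | ω k (fun g => W (z g)) ≠ ω k (fun g => X (z g))}) ∪
        {z : G → Ω | ω k (fun g => W (z g)) ≠ ω k (fun g => X (z g))} := by
      intro z hz
      by_contra hcon
      simp only [Set.mem_union, Set.mem_preimage, Set.mem_ofPred_eq, not_or, not_not] at hcon
      refine hz ?_
      rw [hequiv, hequiv] at hcon
      rw [hequiv, ← hcon.1, ← hcon.2, ← hcoc, ← hbC, hcoc, mul_inv_cancel_right]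
    refine (measureReal_mono hsub).trans ((measureReal_union_le _ _).trans ?_)
    linarith
  have main := hgap (G → Ω) H (bern G m) (fun c z => (c : G) • z)
    (fun c z => ω c (b • fun i => X (z i))) (fun c z => ω c (fun i => X (z i)))
    (fun c => measurePreserving_bernoulli_smul _)
    (fun c => (hω _).comp ((measurable_bernoulli_smul b).comp (hlift X hX).measurable))
    (fun c => (hω _).comp (hlift X hX).measurable)
    (fun z => one_smul G z) (fun c c' z => mul_smul (c : G) (c' : G) z)
    (fun c c' z => by
      rw [hequiv, ← mul_smul b, hbC, mul_smul, ← hcoc]; rfl)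
    (fun c c' z => by rw [hequiv, ← hcoc]; rfl)
    (fun z => ω b (fun i => Y₁ (z i))) (fun z => ω b (fun i => Y₂ (z i)))
    ((hω b).comp (hlift Y₁ hY₁).measurable) ((hω b).comp (hlift Y₂ hY₂).measurable)
    (by
      intro ε hε
      obtain ⟨F, v, hv, hloc, hcl⟩ := exists_local_approx (m := μ₀) (ω b)
        (fun h => hω b (measurableSet_singleton h)) ε hε
      have hvm : Measurable v := measurable_to_countable' hv
      have hcl' : ∀ W : Ω → A, MeasurePreserving W m μ₀ →
          (bern G m).real {z | ω b (fun i => W (z i)) ≠ v (fun i => W (z i))} ≤ ε := fun W hW => by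
        refine le_trans (le_of_eq ?_) hcl
        exact (hlift W hW).measureReal_preimage
          (measurableSet_eq_fun (hω b) hvm).compl.nullMeasurableSet
      refine ⟨fun z => v (fun i => Y₁ (z i)), fun z => v (fun i => Y₂ (z i)),
        hvm.comp (hlift Y₁ hY₁).measurable, hvm.comp (hlift Y₂ hY₂).measurable, hcl' _ hY₁,
        hcl' _ hY₂, ?_⟩
      refine ((finite_not_disjoint_smul F).preimage (f := fun c : C => (c : G)⁻¹)
        (inv_injective.comp Subtype.val_injective).injOn).subset fun c hc => ?_
      by_contra hcon
      refine hc ?_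
      have hcF : ∀ g ∈ F, (c : G)⁻¹ * g ∉ F := fun g hg hg' => hcon ⟨g, hg, _, hg', rfl⟩
      classical
      let S : (G → Ω) → G → Ω := fun z g => if g ∈ F then σ (z g) else z g
      have hS : MeasurePreserving S (bern G m) (bern G m) := by
        refine (measurePreserving_bernoulli_coord (G := G)
          (fun g w => if g ∈ F then σ w else w) fun g => ?_)
        by_cases hg : g ∈ F
        · simpa [hg] using hσ
        · simp only [hg, if_false]
          exact MeasurePreserving.id m
      have hSX : ∀ z, (fun i => X (S z i)) = fun i => X (z i) := by
        intro z; funext i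
        by_cases hi : i ∈ F <;> simp [S, hi, hXσ]
      have hS12 : ∀ z, v (fun i => Y₁ (S z i)) = v (fun i => Y₂ (z i)) := fun z =>
        hloc _ _ fun i hi => by simp [S, hi, h12]
      have hS21 : ∀ z, v (fun i => Y₂ (S z i)) = v (fun i => Y₁ (z i)) := fun z =>
        hloc _ _ fun i hi => by simp [S, hi, h21]
      have hSc : ∀ (W : Ω → A) z, v (fun i => W (((c : G) • S z) i)) =
          v (fun i => W (((c : G) • z) i)) := fun W z =>
        hloc _ _ fun i hi => by
          rw [bernoulli_smul_apply, bernoulli_smul_apply]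
          simp only [S, if_neg (hcF i hi)]
      intro e he
      obtain ⟨W, hW, rfl⟩ : ∃ W : Ω → A, MeasurePreserving W m μ₀ ∧
          e = fun z => v (fun i => W (z i)) := by
        rcases he with rfl | rfl
        exacts [⟨_, hY₁, rfl⟩, ⟨_, hY₂, rfl⟩]
      have hset : {z : G → Ω | v (fun i => W (((c : G) • z) i)) = ω c (b • fun i => X (z i)) *
          v (fun i => Y₁ (z i)) * (ω c (fun i => X (z i)))⁻¹} = S ⁻¹'
          {z : G → Ω | v (fun i => W (((c : G) • z) i)) = ω c (b • fun i => X (z i)) *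
          v (fun i => Y₂ (z i)) * (ω c (fun i => X (z i)))⁻¹} := by
        ext z
        simp only [Set.mem_preimage, Set.mem_ofPred_eq, hSX, hS21, hSc]
      refine (congrArg _ hset).trans (hS.measureReal_preimage ?_)
      refine (measurableSet_eq_fun ?_ ?_).nullMeasurableSet
      · exact (hvm.comp (hlift W hW).measurable).comp (measurable_bernoulli_smul _)
      · exact (((hω _).comp ((measurable_bernoulli_smul b).comp (hlift X hX).measurable)).mul
          (hvm.comp (hlift Y₂ hY₂).measurable)).mul ((hω _).comp (hlift X hX).measurable).inv)
  have hsum := main.trans (Finset.sum_le_card_nsmul K _ (4 * Real.sqrt η) fun k hk => by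
    have h1 := Real.sqrt_le_sqrt (mul_le_mul_of_nonneg_left (hdef Y₁ hY₁ hm k hk)
      (zero_le_two (α := ℝ)))
    have h2 := Real.sqrt_le_sqrt (mul_le_mul_of_nonneg_left (hdef Y₂ hY₂ hm₂ k hk)
      (zero_le_two (α := ℝ)))
    have h3 : Real.sqrt (2 * (2 * η)) = 2 * Real.sqrt η := by
      rw [show 2 * (2 * η) = 2 ^ 2 * η by ring, Real.sqrt_mul (by norm_num),
        Real.sqrt_sq (by norm_num)]
    rw [h3] at h1 h2
    linarith)
  have hsq : Real.sqrt η = κ * Real.sqrt (2 * δ) / (4 * (K.card + 1)) :=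
    Real.sqrt_sq (by positivity)
  rw [hsq, nsmul_eq_mul] at hsum
  have h4 : (K.card : ℝ) * (4 * (κ * Real.sqrt (2 * δ) / (4 * (K.card + 1)))) ≤
      κ * Real.sqrt (2 * δ) := by
    rw [mul_div_assoc', mul_div_assoc', div_le_iff₀ (by positivity)]
    nlinarith [mul_nonneg hκ.le (Real.sqrt_nonneg (2 * δ))]
  have h5 := le_of_mul_le_mul_left (hsum.trans h4) hκ
  have h6 := (Real.sqrt_le_sqrt_iff (by positivity)).1 h5
  linarith

end Uniform

section Transfer

variable {Z H : Type} [MeasurableSpace Z] [Group H] [Countable H] [MeasurableSpace H]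
  [DiscreteMeasurableSpace H] {P : Measure Z} [IsProbabilityMeasure P]

lemma ae_forall_of_ae_prod_count {p : Z × H → Prop}
    (h : ∀ᵐ q ∂(P.prod (Measure.count : Measure H)), p q) : ∀ᵐ z ∂P, ∀ a, p (z, a) := by
  filter_upwards [Measure.ae_ae_of_ae_prod h] with z hz
  exact Measure.ae_count_iff.1 hz

/-- Over an ergodic transformation, two cocycles that stay uniformly close are cohomologous. -/
lemma exists_transfer {T : Z → Z} (hT : Ergodic T P) {L R : Z → H} (hL : Measurable L)
    (hR : Measurable R) (f : ℕ → Z → H) (hf : ∀ n, Measurable (f n)) (hf0 : ∀ z, f 0 z = 1)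
    (hfs : ∀ n z, f (n + 1) z = (L z)⁻¹ * f n (T z) * R z)
    (hclose : ∀ n, P.real {z | f n z ≠ 1} ≤ 1 / 4) :
    ∃ φ : Z → H, Measurable φ ∧ ∀ᵐ z ∂P, φ (T z) = L z * φ z * (R z)⁻¹ := by
  set Q : Measure (Z × H) := P.prod Measure.count with hQ
  let τ : Z × H → Z × H := fun p => (T p.1, L p.1 * p.2 * (R p.1)⁻¹)
  have hτ : MeasurePreserving τ Q Q := measurePreserving_skew hT.toMeasurePreserving hL hR
  let U : Lp ℝ 2 Q →ₗᵢ[ℝ] Lp ℝ 2 Q := Lp.compMeasurePreservingₗᵢ ℝ τ hτ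
  have hU : ∀ v, ⇑(U v) =ᵐ[Q] v ∘ τ := fun v => Lp.coeFn_compMeasurePreserving v hτ
  have hUf : ∀ n, U (graphVec P (f n) (hf n)) = graphVec P (f (n + 1)) (hf (n + 1)) := by
    intro n
    refine Lp.ext ((hU _).trans ?_)
    refine (hτ.quasiMeasurePreserving.ae_eq_comp indicatorConstLp_coeFn).trans ?_
    refine Filter.EventuallyEq.trans ?_ indicatorConstLp_coeFn.symm
    refine Filter.Eventually.of_forall fun p => ?_
    have : τ p ∈ graphSet (f n) ↔ p ∈ graphSet (f (n + 1)) := by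
      simp only [graphSet, Set.mem_ofPred_eq, τ, hfs]
      constructor
      · intro h
        rw [h]
        group
      · intro h
        rw [← h]
        group
    by_cases hp : τ p ∈ graphSet (f n)
    · rw [Function.comp_apply, Set.indicator_of_mem hp, Set.indicator_of_mem (this.1 hp)]
    · rw [Function.comp_apply, Set.indicator_of_notMem hp, Set.indicator_of_notMem (mt this.2 hp)]
  set ξ := graphVec P (f 0) (hf 0) with hξ
  let U' : Lp ℝ 2 Q →L[ℝ] Lp ℝ 2 Q := U.toContinuousLinearMap
  have hit : ∀ n, U'^[n] ξ = graphVec P (f n) (hf n) := by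
    intro n
    induction n with
    | zero => rfl
    | succ n ih => rw [Function.iterate_succ_apply', ih]; exact hUf n
  have hlim := U'.tendsto_birkhoffAverage_orthogonalProjection
    U.norm_toContinuousLinearMap_le ξ
  set η : Lp ℝ 2 Q := ((U'.eqLocus (1 : Lp ℝ 2 Q →L[ℝ] Lp ℝ 2 Q)).orthogonalProjectionOnto ξ).1
    with hη
  have hηfix : U η = η :=
    ((U'.eqLocus (1 : Lp ℝ 2 Q →L[ℝ] Lp ℝ 2 Q)).orthogonalProjectionOnto ξ).2
  have havg : ∀ N, birkhoffAverage ℝ U' _root_.id N ξ =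
      (N : ℝ)⁻¹ • ∑ n ∈ Finset.range N, graphVec P (f n) (hf n) := by
    intro N
    simp only [birkhoffAverage, birkhoffSum, hit, id]
  -- correlation with the initial vector
  have hcorr : 3 / 4 ≤ inner ℝ ξ η := by
    have h1 := (Filter.Tendsto.inner (𝕜 := ℝ) (tendsto_const_nhds (x := ξ)) hlim)
    refine ge_of_tendsto h1 (Filter.eventually_atTop.2 ⟨1, fun N hN => ?_⟩)
    rw [havg, inner_smul_right, inner_sum]
    have h2 : ∀ n ∈ Finset.range N, (3 / 4 : ℝ) ≤ inner ℝ ξ (graphVec P (f n) (hf n)) := by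
      intro n _
      rw [hξ, inner_graphVec]
      have h3 : {z | f 0 z = f n z} = {z | f n z ≠ 1}ᶜ := by
        ext z; simp only [hf0, Set.mem_ofPred_eq, Set.mem_compl_iff, not_not, eq_comm]
      have h5 : MeasurableSet {z | f n z ≠ 1} :=
        (measurableSet_eq_fun (hf n) measurable_const).compl
      rw [h3, probReal_compl_eq_one_sub h5]
      linarith [hclose n]
    have h4 := Finset.card_nsmul_le_sum _ _ _ h2
    rw [Finset.card_range, nsmul_eq_mul] at h4
    have hN' : (0 : ℝ) < N := by exact_mod_cast hN
    rw [inv_mul_eq_div, le_div_iff₀ hN']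
    linarith
  -- the limit is a sub-probability in the group variable, up to two points
  have hpair : ∀ᵐ z ∂P, ∀ a b : H, a ≠ b → η (z, a) + η (z, b) ≤ 1 := by
    obtain ⟨ns, -, hns⟩ := (tendstoInMeasure_of_tendsto_Lp hlim).exists_seq_tendsto_ae
    have h1 : ∀ᵐ z ∂P, ∀ n a, (graphVec P (f n) (hf n)) (z, a) =
        (graphSet (f n)).indicator (fun _ => (1 : ℝ)) (z, a) :=
      ae_all_iff.2 fun n => ae_forall_of_ae_prod_count indicatorConstLp_coeFn
    have h2 : ∀ᵐ z ∂P, ∀ N a, (∑ n ∈ Finset.range N, graphVec P (f n) (hf n) : Lp ℝ 2 Q) (z, a) =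
        ∑ n ∈ Finset.range N, (graphVec P (f n) (hf n)) (z, a) :=
      ae_all_iff.2 fun N => ae_forall_of_ae_prod_count
        (p := fun q => (∑ n ∈ Finset.range N, graphVec P (f n) (hf n) : Lp ℝ 2 Q) q =
          ∑ n ∈ Finset.range N, (graphVec P (f n) (hf n)) q) (by
        filter_upwards [Lp.coeFn_finsetSum (Finset.range N) fun n => graphVec P (f n) (hf n)]
          with q hq
        rw [hq]; simp)
    have h3 : ∀ᵐ z ∂P, ∀ N a, (birkhoffAverage ℝ U' _root_.id N ξ) (z, a) = (N : ℝ)⁻¹ *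
        (∑ n ∈ Finset.range N, graphVec P (f n) (hf n) : Lp ℝ 2 Q) (z, a) :=
      ae_all_iff.2 fun N => ae_forall_of_ae_prod_count
        (p := fun q => (birkhoffAverage ℝ U' _root_.id N ξ) q = (N : ℝ)⁻¹ *
          (∑ n ∈ Finset.range N, graphVec P (f n) (hf n) : Lp ℝ 2 Q) q) (by
        rw [havg]
        filter_upwards [Lp.coeFn_smul (N : ℝ)⁻¹
          (∑ n ∈ Finset.range N, graphVec P (f n) (hf n) : Lp ℝ 2 Q)] with q hq
        rw [hq]; rfl)
    classical
    filter_upwards [h1, h2, h3, ae_forall_of_ae_prod_count hns] with z h1 h2 h3 h4 a b hab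
    refine le_of_tendsto ((h4 a).add (h4 b)) (Filter.Eventually.of_forall fun i => ?_)
    rw [h3, h3, h2, h2, ← mul_add, ← Finset.sum_add_distrib]
    have h5 : ∑ n ∈ Finset.range (ns i), ((graphVec P (f n) (hf n)) (z, a) +
        (graphVec P (f n) (hf n)) (z, b)) ≤ (Finset.range (ns i)).card • (1 : ℝ) := by
      refine Finset.sum_le_card_nsmul _ _ _ fun n _ => ?_
      have hb1 : (graphSet (f n)).indicator (fun _ => (1 : ℝ)) (z, b) ≤ 1 :=
        Set.indicator_le' (fun _ _ => le_rfl) (fun _ _ => zero_le_one) _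
      rw [h1, h1]
      by_cases ha : (z, a) ∈ graphSet (f n)
      · have hb : (z, b) ∉ graphSet (f n) := fun hb => hab (ha.symm.trans hb)
        rw [Set.indicator_of_mem ha, Set.indicator_of_notMem hb, add_zero]
      · rwa [Set.indicator_of_notMem ha, zero_add]
    rw [Finset.card_range, nsmul_eq_mul, mul_one] at h5
    exact (mul_le_mul_of_nonneg_left h5 (by positivity)).trans (inv_mul_le_one)
  have hinv : ∀ᵐ z ∂P, ∀ a, η (T z, L z * a * (R z)⁻¹) = η (z, a) := by
    refine ae_forall_of_ae_prod_count (p := fun q => η (τ q) = η q) ?_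
    have := hU η
    rw [hηfix] at this
    filter_upwards [this] with q hq using hq.symm
  have hηm : Measurable η := (Lp.stronglyMeasurable η).measurable
  let S : H → Set Z := fun a => {z | 1 / 2 < η (z, a)}
  have hS : ∀ a, MeasurableSet (S a) := fun a =>
    measurableSet_lt measurable_const (hηm.comp measurable_prodMk_right)
  have hE : ∀ᵐ z ∂P, ∃ a, z ∈ S a := by
    have hEm : MeasurableSet (⋃ a, S a) := MeasurableSet.iUnion hS
    have hpre : T ⁻¹' (⋃ a, S a) =ᵐ[P] ⋃ a, S a := by
      filter_upwards [hinv] with z hz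
      refine propext ?_
      change z ∈ T ⁻¹' (⋃ a, S a) ↔ z ∈ ⋃ a, S a
      simp only [Set.mem_preimage, Set.mem_iUnion, S, Set.mem_ofPred_eq]
      constructor
      · rintro ⟨a, ha⟩
        refine ⟨(L z)⁻¹ * a * R z, ?_⟩
        rw [← hz]
        convert ha using 3
        group
      · rintro ⟨a, ha⟩
        exact ⟨_, by rw [hz]; exact ha⟩
    rcases hT.quasiErgodic.ae_empty_or_univ₀ hEm.nullMeasurableSet hpre with h0 | h1
    · exfalso
      have hle : ∀ᵐ q ∂Q, q ∈ graphSet (f 0) → η q ≤ 1 / 2 := by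
        have hms : MeasurableSet {q : Z × H | η q ≤ 1 / 2} := measurableSet_le hηm measurable_const
        have : ∀ᵐ q ∂Q, η q ≤ 1 / 2 := by
          refine (Measure.ae_prod_iff_ae_ae hms).2 ?_
          filter_upwards [h0] with z hz
          refine Filter.Eventually.of_forall fun a => not_lt.1 fun hlt => ?_
          have hz' : z ∈ ⋃ a, S a := Set.mem_iUnion.2 ⟨a, hlt⟩
          exact (show ¬ (z ∈ (∅ : Set Z)) from fun h => h) (hz.mp hz')
        filter_upwards [this] with q hq _ using hq
      have h2 : inner ℝ ξ η = ∫ q in graphSet (f 0), η q ∂Q :=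
        L2.inner_indicatorConstLp_one (measurableSet_graphSet (hf 0))
          (measure_graphSet_ne_top (hf 0)) η
      have hreal : Q.real (graphSet (f 0)) = 1 := by
        rw [Measure.real, ← Set.inter_self (graphSet (f 0)), measure_graphSet_inter (hf 0) (hf 0)]
        simp
      have h3 : ∫ q in graphSet (f 0), η q ∂Q ≤ ∫ q in graphSet (f 0), (1 / 2 : ℝ) ∂Q := by
        refine setIntegral_mono_on_ae ?_ ?_ (measurableSet_graphSet (hf 0)) hle
        · exact integrableOn_Lp_of_measure_ne_top η (by norm_num) (measure_graphSet_ne_top (hf 0))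
        · exact integrableOn_const (measure_graphSet_ne_top (hf 0))
      rw [setIntegral_const, hreal, one_smul] at h3
      linarith
    · filter_upwards [h1] with z hz
      have : z ∈ ⋃ a, S a := hz.mpr trivial
      exact Set.mem_iUnion.1 this
  let S' : H → Set Z := fun a => S a ∩ ⋂ b : {b : H // b ≠ a}, (S b)ᶜ
  obtain ⟨φ, hφ, hφS⟩ := exists_measurable_piecewise S'
    (fun a => (hS a).inter (MeasurableSet.iInter fun b => (hS b).compl))
    (fun a _ => a) (fun a => measurable_const) (by
      intro a b hab z hz
      exact absurd hz.2.1 (Set.mem_iInter.1 hz.1.2 ⟨b, hab.symm⟩))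
  have huniq : ∀ᵐ z ∂P, ∀ a, z ∈ S a → φ z = a := by
    filter_upwards [hpair] with z hz a ha
    refine hφS a ⟨ha, Set.mem_iInter.2 fun b hb => ?_⟩
    have h1 := hz b a b.2
    simp only [S, Set.mem_ofPred_eq] at ha hb
    linarith
  refine ⟨φ, hφ, ?_⟩
  filter_upwards [hE, huniq, hT.quasiMeasurePreserving.ae huniq, hinv] with z ⟨a, ha⟩ h1 h2 h3
  rw [h1 a ha]
  refine h2 _ ?_
  simp only [S, Set.mem_ofPred_eq]
  rw [h3]
  exact ha

end Transfer

section Chain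

lemma measurePreserving_fiberwise {U B D : Type} [Countable U] [MeasurableSpace U]
    [DiscreteMeasurableSpace U] [MeasurableSpace B] [MeasurableSpace D] {υ : Measure U}
    {β : Measure B} {γ : Measure D} [IsProbabilityMeasure υ] [IsProbabilityMeasure β]
    {g : U → B → D} (hg : ∀ u, MeasurePreserving (g u) β γ) :
    MeasurePreserving (fun p : U × B => (p.1, g p.1 p.2)) (υ.prod β) (υ.prod γ) :=
  (MeasurePreserving.id υ).skew_product
    (measurable_from_prod_countable_right fun u => (hg u).measurable)
    (Filter.Eventually.of_forall fun u => (hg u).map_eq)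

/-- The base measure of the chain of intermediate actions. -/
noncomputable abbrev chainMeasure (n : ℕ) {D : Type} [MeasurableSpace D] (m : Measure D) :
    Measure (Fin (n + 1) × D) :=
  (PMF.uniformOfFintype (Fin (n + 1))).toMeasure.prod m

/-- The `k`-th step of the chain interpolating between the two coordinates. -/
def chainStep {A : Type} (n k : ℕ) (w : Fin (n + 1) × A × A) : A :=
  if w.1.val < k then w.2.2 else w.2.1

variable {G : Type} [Group G] {H : Type} [Group H] [Countable H]
  [MeasurableSpace H] [DiscreteMeasurableSpace H] {A : Type} [MeasurableSpace A]
  {μ₀ : Measure A} [IsProbabilityMeasure μ₀]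

lemma measurePreserving_chainStep (n k : ℕ) :
    MeasurePreserving (chainStep (A := A) n k) (chainMeasure n (μ₀.prod μ₀)) μ₀ := by
  have h := measurePreserving_fiberwise (υ := (PMF.uniformOfFintype (Fin (n + 1))).toMeasure)
    (β := μ₀.prod μ₀) (γ := μ₀)
    (g := fun u (p : A × A) => if u.val < k then p.2 else p.1) (fun u => by
      by_cases hu : u.val < k
      · simp only [hu, if_true]
        exact measurePreserving_snd
      · simp only [hu, if_false]
        exact measurePreserving_fst)
  exact measurePreserving_snd.comp h

lemma chainMeasure_real_fst_eq (n : ℕ) {D : Type} [MeasurableSpace D] (m : Measure D)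
    [IsProbabilityMeasure m] (u : Fin (n + 1)) :
    (chainMeasure n m).real {w | w.1 = u} = 1 / (n + 1 : ℝ) := by
  have h1 : {w : Fin (n + 1) × D | w.1 = u} = Prod.fst ⁻¹' {u} := rfl
  rw [h1, measurePreserving_fst.measureReal_preimage (measurableSet_singleton u).nullMeasurableSet,
    Measure.real, PMF.toMeasure_apply_singleton _ _ (measurableSet_singleton u),
    PMF.uniformOfFintype_apply, Fintype.card_fin, ENNReal.toReal_inv, ENNReal.toReal_natCast]
  push_cast
  rw [one_div]

variable [StandardBorelSpace A]

/-- Along a sufficiently fine chain, consecutive steps give uniformly close cocycles. -/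
lemma exists_chain_close (C : Subgroup G) (hC : ¬ IsAmenable C) (ω : G → (G → A) → H)
    (hω : ∀ g, Measurable (ω g)) (hcoc : ∀ g h x, ω (g * h) x = ω g (h • x) * ω h x)
    (δ : ℝ) (hδ : 0 < δ) :
    ∃ n : ℕ, ∀ k < n + 1, ∀ b : G, (∀ c ∈ C, Commute b c) →
      (bern G (chainMeasure n (μ₀.prod μ₀))).real {z | ω b (fun g => chainStep n k (z g)) ≠
        ω b (fun g => chainStep n (k + 1) (z g))} ≤ δ := by
  obtain ⟨θ, hθ, hclose⟩ := exists_forall_cocycle_close (μ₀ := μ₀) C hC ω hω hcoc δ hδ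
  obtain ⟨n, hn⟩ := exists_nat_one_div_lt hθ
  refine ⟨n, fun k hk b hb => ?_⟩
  set m := chainMeasure n (μ₀.prod (μ₀.prod μ₀))
  let p : Fin (n + 1) × A × A × A → Fin (n + 1) × A × A := fun w =>
    (w.1, if w.1.val < k then (w.2.2.1, w.2.1) else
      if w.1.val = k then w.2.2 else (w.2.1, w.2.2.1))
  have hp : MeasurePreserving p m (chainMeasure n (μ₀.prod μ₀)) := by
    refine measurePreserving_fiberwise (g := fun (u : Fin (n + 1)) (q : A × A × A) => if u.val < k then
      (q.2.1, q.1) else if u.val = k then q.2 else (q.1, q.2.1)) fun u => ?_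
    have h1 : MeasurePreserving (fun q : A × A × A => (q.1, q.2.1)) (μ₀.prod (μ₀.prod μ₀))
        (μ₀.prod μ₀) := (MeasurePreserving.id μ₀).prod measurePreserving_fst
    by_cases hu : u.val < k
    · simp only [hu, if_true]
      exact Measure.measurePreserving_swap.comp h1
    · by_cases hu' : u.val = k
      · simp only [hu', lt_irrefl, if_false, if_true]
        exact measurePreserving_snd
      · simp only [hu, hu', if_false]
        exact h1
  let Y₁ : Fin (n + 1) × A × A × A → A := fun w => chainStep n k (p w)
  let Y₂ : Fin (n + 1) × A × A × A → A := fun w => chainStep n (k + 1) (p w)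
  have hY₁ : ∀ w, Y₁ w = if w.1.val = k then w.2.2.1 else w.2.1 := by
    intro w
    simp only [Y₁, chainStep, p]
    rcases lt_trichotomy w.1.val k with h | h | h
    · simp [h, h.ne]
    · simp [h]
    · simp [h.not_gt, h.ne']
  have hY₂ : ∀ w, Y₂ w = if w.1.val = k then w.2.2.2 else w.2.1 := by
    intro w
    simp only [Y₂, chainStep, p]
    rcases lt_trichotomy w.1.val k with h | h | h
    · simp [h, h.ne, h.trans (Nat.lt_succ_self k)]
    · simp [h]
    · simp [h.not_gt, h.ne', Nat.not_lt.2 (Nat.succ_le_of_lt h)]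
  let σ : Fin (n + 1) × A × A × A → Fin (n + 1) × A × A × A :=
    Prod.map id (Prod.map id Prod.swap)
  have hσ : MeasurePreserving σ m m :=
    (MeasurePreserving.id _).prod ((MeasurePreserving.id _).prod Measure.measurePreserving_swap)
  have hle : m.real {w | Y₁ w ≠ w.2.1} ≤ θ := by
    have hsub : {w : Fin (n + 1) × A × A × A | Y₁ w ≠ w.2.1} ⊆ {w | w.1 = ⟨k, hk⟩} := by
      intro w hw
      by_contra hcon
      refine hw ?_
      rw [hY₁, if_neg fun h => hcon (Fin.ext h)]
    refine (measureReal_mono hsub).trans ?_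
    rw [chainMeasure_real_fst_eq]
    exact hn.le
  have hX : MeasurePreserving (fun w : Fin (n + 1) × A × A × A => w.2.1) m μ₀ :=
    measurePreserving_fst.comp measurePreserving_snd
  have key := hclose _ m (fun w => w.2.1) Y₁ Y₂ σ hX ((measurePreserving_chainStep n k).comp hp)
    ((measurePreserving_chainStep n (k + 1)).comp hp) hσ (fun w => rfl)
    (fun w => by rw [hY₁, hY₂]; rfl) (fun w => by rw [hY₁, hY₂]; rfl) hle b hb
  refine le_trans (le_of_eq ?_) key
  have hlift : ∀ j, Measurable fun (z : G → Fin (n + 1) × A × A) g => chainStep n j (z g) :=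
    fun j => (measurePreserving_bernoulli_coord (G := G) (fun _ => chainStep n j)
      fun _ => measurePreserving_chainStep (μ₀ := μ₀) n j).measurable
  have hms : MeasurableSet {z : G → Fin (n + 1) × A × A | ω b (fun g => chainStep n k (z g)) ≠
        ω b (fun g => chainStep n (k + 1) (z g))} :=
    (measurableSet_eq_fun ((hω b).comp (hlift k)) ((hω b).comp (hlift (k + 1)))).compl
  exact ((measurePreserving_bernoulli_coord (G := G) (fun _ => p) fun _ => hp).measureReal_preimage
    hms.nullMeasurableSet).symm

/-- A cocycle restricted to an infinite order element centralizing a nonamenable subgroup is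
cohomologous to itself after doubling the variables. -/
lemma exists_doubling_transfer (C : Subgroup G) (hC : ¬ IsAmenable C) (s : G)
    (hs : ¬ IsOfFinOrder s) (hsC : ∀ c ∈ C, Commute s c) [Countable G] (ω : G → (G → A) → H)
    (hω : ∀ g, Measurable (ω g)) (hcoc : ∀ g h x, ω (g * h) x = ω g (h • x) * ω h x) :
    ∃ (n : ℕ) (Φ : (G → Fin (n + 1) × A × A) → H), Measurable Φ ∧
      ∀ᵐ z ∂(bern G (chainMeasure n (μ₀.prod μ₀))),
        Φ (s • z) = ω s (fun g => (z g).2.1) * Φ z * (ω s fun g => (z g).2.2)⁻¹ := by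
  obtain ⟨n, hn⟩ := exists_chain_close (μ₀ := μ₀) C hC ω hω hcoc (1 / 4) (by norm_num)
  set P := bern G (chainMeasure n (μ₀.prod μ₀))
  have hlift : ∀ j, Measurable fun (z : G → Fin (n + 1) × A × A) g => chainStep n j (z g) :=
    fun j => (measurePreserving_bernoulli_coord (G := G) (fun _ => chainStep n j)
      fun _ => measurePreserving_chainStep (μ₀ := μ₀) n j).measurable
  have hω1 : ∀ x, ω 1 x = 1 := fun x => by
    have := hcoc 1 1 x
    rw [one_smul, mul_one] at this
    exact left_eq_mul.1 this
  have herg : Ergodic (fun z : G → Fin (n + 1) × A × A => s • z) P := ergodic_bernoulli_smul hs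
  have hstep : ∀ k < n + 1, ∃ φ : (G → Fin (n + 1) × A × A) → H, Measurable φ ∧
      ∀ᵐ z ∂P, φ (s • z) = ω s (fun g => chainStep n k (z g)) * φ z *
        (ω s fun g => chainStep n (k + 1) (z g))⁻¹ := by
    intro k hk
    refine exists_transfer herg ((hω s).comp (hlift k)) ((hω s).comp (hlift (k + 1)))
      (fun j z => (ω (s ^ j) fun g => chainStep n k (z g))⁻¹ *
        ω (s ^ j) fun g => chainStep n (k + 1) (z g))
      (fun j => ((hω _).comp (hlift k)).inv.mul ((hω _).comp (hlift (k + 1))))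
      (fun z => by rw [pow_zero, hω1, hω1, inv_one, mul_one]) (fun j z => ?_) (fun j => ?_)
    · rw [pow_succ, hcoc, hcoc, mul_inv_rev]
      simp only [mul_assoc]
      rfl
    · have h := hn k hk (s ^ j) fun c hc => (hsC c hc).pow_left j
      refine le_trans (le_of_eq ?_) h
      congr 1
      ext z
      simp only [Set.mem_ofPred_eq, ne_eq, inv_mul_eq_one]
  have hall : ∀ k ≤ n + 1, ∃ φ : (G → Fin (n + 1) × A × A) → H, Measurable φ ∧
      ∀ᵐ z ∂P, φ (s • z) = ω s (fun g => chainStep n 0 (z g)) * φ z *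
        (ω s fun g => chainStep n k (z g))⁻¹ := by
    intro k
    induction k with
    | zero =>
      intro _
      exact ⟨fun _ => 1, measurable_const, Filter.Eventually.of_forall fun z => by simp⟩
    | succ k ih =>
      intro hk
      obtain ⟨φ, hφ, h1⟩ := ih (by omega)
      obtain ⟨ψ, hψ, h2⟩ := hstep k (by omega)
      refine ⟨fun z => φ z * ψ z, hφ.mul hψ, ?_⟩
      filter_upwards [h1, h2] with z h1 h2
      rw [h1, h2]
      group
  obtain ⟨Φ, hΦ, h⟩ := hall (n + 1) le_rfl
  refine ⟨n, Φ, hΦ, ?_⟩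
  have h0 : ∀ w : Fin (n + 1) × A × A, chainStep n 0 w = w.2.1 := fun w => by simp [chainStep]
  have h1 : ∀ w : Fin (n + 1) × A × A, chainStep n (n + 1) w = w.2.2 := fun w => by
    simp [chainStep, w.1.isLt]
  simpa only [h0, h1] using h

end Chain

section Separation

lemma measurePreserving_prodProdProdComm {V W X Y : Type} [MeasurableSpace V] [MeasurableSpace W]
    [MeasurableSpace X] [MeasurableSpace Y] (μV : Measure V) (μW : Measure W) (μX : Measure X)
    (μY : Measure Y) [IsProbabilityMeasure μV] [IsProbabilityMeasure μW]
    [IsProbabilityMeasure μX] [IsProbabilityMeasure μY] :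
    MeasurePreserving (fun p : (V × W) × X × Y => ((p.1.1, p.2.1), (p.1.2, p.2.2)))
      ((μV.prod μW).prod (μX.prod μY)) ((μV.prod μX).prod (μW.prod μY)) := by
  have h1 := measurePreserving_prodAssoc μV μW (μX.prod μY)
  have h2 := (MeasurePreserving.id μV).prod (measurePreserving_prodAssoc μW μX μY).symm
  have h3 := (MeasurePreserving.id μV).prod
    ((Measure.measurePreserving_swap (μ := μW) (ν := μX)).prod (MeasurePreserving.id μY))
  have h4 := (MeasurePreserving.id μV).prod (measurePreserving_prodAssoc μX μW μY)
  have h5 := (measurePreserving_prodAssoc μV μX (μW.prod μY)).symm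
  exact h5.comp (h4.comp (h3.comp (h2.comp h1)))

lemma exists_measure_fiber_pos {X H : Type} [Countable H] [MeasurableSpace X] (P : Measure X)
    [IsProbabilityMeasure P] (f : X → H) : ∃ c, 0 < P (f ⁻¹' {c}) := by
  by_contra! h
  have : (Set.univ : Set X) = ⋃ c : H, f ⁻¹' {c} := by ext; simp
  have h1 : P Set.univ = 0 := by
    rw [this, measure_iUnion_null fun c => le_antisymm (h c) zero_le]
  simp at h1

lemma not_ae_ne_prod_self {X H : Type} [Countable H] [MeasurableSpace X] {P : Measure X}
    [IsProbabilityMeasure P] (f : X → H) :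
    ¬ ∀ᵐ p ∂P.prod P, f p.1 ≠ f p.2 := by
  intro h
  obtain ⟨c, hc⟩ := exists_measure_fiber_pos P f
  have h0 : (P.prod P) ((f ⁻¹' {c}) ×ˢ (f ⁻¹' {c})) = 0 :=
    measure_mono_null (fun p hp => by
      simp only [Set.mem_prod, Set.mem_preimage, Set.mem_singleton_iff] at hp
      simp [hp.1, hp.2]) h
  rw [Measure.prod_prod] at h0
  exact hc.ne' (mul_self_eq_zero.1 h0)

variable {H : Type} [Group H] [Countable H] [MeasurableSpace H] [DiscreteMeasurableSpace H]
  {V X : Type} [MeasurableSpace V] [MeasurableSpace X] {Q : Measure V} {P : Measure X}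
  [IsProbabilityMeasure Q] [IsProbabilityMeasure P]

/-- Separation of variables for a transfer function between two cocycles living on different
factors of a product. -/
lemma exists_separation {T : V → V} {S : X → X}
    (hE : Ergodic (Prod.map (Prod.map T T) (Prod.map S S)) ((Q.prod Q).prod (P.prod P)))
    (hT : MeasurePreserving T Q Q) (hS : MeasurePreserving S P P)
    {a : X → H} {b : V → H} {Φ : V × X → H} (hΦ : Measurable Φ)
    (h : ∀ᵐ p ∂Q.prod P, Φ (T p.1, S p.2) = a p.2 * Φ p * (b p.1)⁻¹) :
    ∃ (q : X → H) (α : H), Measurable q ∧ ∀ᵐ x ∂P, (q (S x))⁻¹ * a x * q x = α := by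
  let E : Set ((V × V) × X × X) :=
    {p | Φ (p.1.2, p.2.2) * (Φ (p.1.2, p.2.1))⁻¹ = Φ (p.1.1, p.2.2) * (Φ (p.1.1, p.2.1))⁻¹}
  have hcomm := measurePreserving_prodProdProdComm Q Q P P
  have hcomm' := measurePreserving_prodProdProdComm Q P Q P
  have m1 : ∀ {W : Type} [MeasurableSpace W] {u : W → V × X}, Measurable u →
      Measurable fun p => Φ (u p) := fun hu => hΦ.comp hu
  have hEm : MeasurableSet E :=
    measurableSet_eq_fun ((m1 (by fun_prop)).mul (m1 (by fun_prop)).inv)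
      ((m1 (by fun_prop)).mul (m1 (by fun_prop)).inv)
  have hpt : ∀ {u : (V × V) × X × X → V × X},
      MeasurePreserving u ((Q.prod Q).prod (P.prod P)) (Q.prod P) →
      ∀ᵐ p ∂((Q.prod Q).prod (P.prod P)),
        Φ (T (u p).1, S (u p).2) = a (u p).2 * Φ (u p) * (b (u p).1)⁻¹ :=
    fun hu => hu.quasiMeasurePreserving.ae h
  have hff : MeasurePreserving (fun p : (V × V) × X × X => (p.1.1, p.2.1))
      ((Q.prod Q).prod (P.prod P)) (Q.prod P) := measurePreserving_fst.comp hcomm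
  have hss : MeasurePreserving (fun p : (V × V) × X × X => (p.1.2, p.2.2))
      ((Q.prod Q).prod (P.prod P)) (Q.prod P) := measurePreserving_snd.comp hcomm
  have hfs : MeasurePreserving (fun p : (V × V) × X × X => (p.1.1, p.2.2))
      ((Q.prod Q).prod (P.prod P)) (Q.prod P) :=
    measurePreserving_fst.prod measurePreserving_snd
  have hsf : MeasurePreserving (fun p : (V × V) × X × X => (p.1.2, p.2.1))
      ((Q.prod Q).prod (P.prod P)) (Q.prod P) :=
    measurePreserving_snd.prod measurePreserving_fst
  have hEinv : Prod.map (Prod.map T T) (Prod.map S S) ⁻¹' E =ᵐ[(Q.prod Q).prod (P.prod P)] E := by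
    filter_upwards [hpt hff, hpt hfs, hpt hsf, hpt hss] with p p1 p2 p3 p4
    refine propext ?_
    change Φ (T p.1.2, S p.2.2) * (Φ (T p.1.2, S p.2.1))⁻¹ =
      Φ (T p.1.1, S p.2.2) * (Φ (T p.1.1, S p.2.1))⁻¹ ↔
      Φ (p.1.2, p.2.2) * (Φ (p.1.2, p.2.1))⁻¹ = Φ (p.1.1, p.2.2) * (Φ (p.1.1, p.2.1))⁻¹
    rw [p1, p2, p3, p4]
    simp only [mul_inv_rev, inv_inv, mul_assoc, inv_mul_cancel_left, mul_right_inj]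
    simp only [← mul_assoc, mul_left_inj]
  have hfull : ∀ᵐ p ∂((Q.prod Q).prod (P.prod P)), p ∈ E := by
    rcases hE.quasiErgodic.ae_mem_or_ae_notMem₀ hEm.nullMeasurableSet hEinv with h0 | h0
    · exact h0
    · exfalso
      obtain ⟨⟨w, v⟩, hwv⟩ := (Measure.ae_ae_of_ae_prod h0).exists
      refine not_ae_ne_prod_self (P := P) (fun x => (Φ (w, x))⁻¹ * Φ (v, x)) ?_
      filter_upwards [hwv] with p hp heq
      refine hp ?_
      change Φ (v, p.2) * (Φ (v, p.1))⁻¹ = Φ (w, p.2) * (Φ (w, p.1))⁻¹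
      change (Φ (w, p.1))⁻¹ * Φ (v, p.1) = (Φ (w, p.2))⁻¹ * Φ (v, p.2) at heq
      have : Φ (v, p.2) = Φ (w, p.2) * ((Φ (w, p.1))⁻¹ * Φ (v, p.1)) := by rw [heq]; group
      rw [this]
      group
  obtain ⟨⟨w, x₀⟩, hw⟩ := (Measure.ae_ae_of_ae_prod (hcomm'.quasiMeasurePreserving.ae hfull)).exists
  have hw' : ∀ᵐ p ∂Q.prod P, Φ p = Φ (w, p.2) * ((Φ (w, x₀))⁻¹ * Φ (p.1, x₀)) := by
    filter_upwards [hw] with p hp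
    change Φ (p.1, p.2) * (Φ (p.1, x₀))⁻¹ = Φ (w, p.2) * (Φ (w, x₀))⁻¹ at hp
    rw [← mul_assoc, ← hp, inv_mul_cancel_right]
  have hfin : ∀ᵐ p ∂P.prod Q, (Φ (w, S p.1))⁻¹ * a p.1 * Φ (w, p.1) =
      (Φ (w, x₀))⁻¹ * Φ (T p.2, x₀) * b p.2 * ((Φ (w, x₀))⁻¹ * Φ (p.2, x₀))⁻¹ := by
    have hsw := (Measure.measurePreserving_swap (μ := P) (ν := Q)).quasiMeasurePreserving
    filter_upwards [hsw.ae h, hsw.ae hw', hsw.ae ((hT.prod hS).quasiMeasurePreserving.ae hw')]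
      with p p1 p2 p3
    simp only [Prod.fst_swap, Prod.snd_swap, Prod.map_fst, Prod.map_snd] at p1 p2 p3
    change Φ (T p.2, S p.1) = _ at p3
    rw [p3, p2] at p1
    have : a p.1 = Φ (w, S p.1) * ((Φ (w, x₀))⁻¹ * Φ (T p.2, x₀)) * b p.2 *
        (Φ (w, p.1) * ((Φ (w, x₀))⁻¹ * Φ (p.2, x₀)))⁻¹ := by
      rw [p1]; group
    rw [this]
    group
  have hsw := (Measure.measurePreserving_swap (μ := Q) (ν := P)).quasiMeasurePreserving
  obtain ⟨y, hy⟩ := (Measure.ae_ae_of_ae_prod (hsw.ae hfin)).exists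
  exact ⟨fun x => Φ (w, x), (Φ (w, x₀))⁻¹ * Φ (T y, x₀) * b y * ((Φ (w, x₀))⁻¹ * Φ (y, x₀))⁻¹,
    m1 (by fun_prop), hy⟩

end Separation

section Untwist

variable {G : Type} [Group G] {Ω Ω' : Type} [MeasurableSpace Ω] [MeasurableSpace Ω']
  {m : Measure Ω} [IsProbabilityMeasure m] {m' : Measure Ω'} [IsProbabilityMeasure m']

lemma measurePreserving_bern_zip :
    MeasurePreserving (fun (p : (G → Ω) × (G → Ω')) g => (p.1 g, p.2 g))
      ((bern G m).prod (bern G m')) (bern G (m.prod m')) := by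
  have h := measurePreserving_bern_unzip (G := G) (m := m) (m' := m')
  have hm : Measurable (fun (p : (G → Ω) × (G → Ω')) g => (p.1 g, p.2 g)) := by fun_prop
  refine ⟨hm, ?_⟩
  rw [← h.map_eq, Measure.map_map hm h.measurable]
  exact Measure.map_id

lemma ergodic_bernoulli_smul_prod_prod {s : G} (hs : ¬ IsOfFinOrder s) :
    Ergodic (Prod.map (Prod.map (fun z : G → Ω => s • z) (fun z : G → Ω => s • z))
        (Prod.map (fun z : G → Ω' => s • z) (fun z : G → Ω' => s • z)))
      (((bern G m).prod (bern G m)).prod ((bern G m').prod (bern G m'))) :=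
  ((measurePreserving_bern_unzip (G := G) (m := m) (m' := m)).prod
    (measurePreserving_bern_unzip (G := G) (m := m') (m' := m'))).ergodic_of_ergodic_semiconj
    (ergodic_bernoulli_smul_prod (m := m.prod m) (m' := m'.prod m') hs)
    (((measurable_bernoulli_smul s).prodMap (measurable_bernoulli_smul s)).prodMap
      ((measurable_bernoulli_smul s).prodMap (measurable_bernoulli_smul s))) fun _ => rfl

variable {H : Type} [Group H] [Countable H] [MeasurableSpace H] [DiscreteMeasurableSpace H]
  {A : Type} [MeasurableSpace A] [StandardBorelSpace A] {μ₀ : Measure A} [IsProbabilityMeasure μ₀]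

/-- A cocycle over a Bernoulli action can be made constant on an infinite order element with
nonamenable centralizer. -/
lemma exists_untwist (C : Subgroup G) (hC : ¬ IsAmenable C) (s : G) (hs : ¬ IsOfFinOrder s)
    (hsC : ∀ c ∈ C, Commute s c) [Countable G] (ω : G → (G → A) → H)
    (hω : ∀ g, Measurable (ω g)) (hcoc : ∀ g h x, ω (g * h) x = ω g (h • x) * ω h x) :
    ∃ (q : (G → A) → H) (α : H), Measurable q ∧
      ∀ᵐ x ∂bern G μ₀, (q (s • x))⁻¹ * ω s x * q x = α := by
  obtain ⟨n, Φ, hΦ, h⟩ := exists_doubling_transfer (μ₀ := μ₀) C hC s hs hsC ω hω hcoc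
  have hr : MeasurePreserving (fun w : (Fin (n + 1) × A) × A => (w.1.1, w.2, w.1.2))
      ((chainMeasure n μ₀).prod μ₀) (chainMeasure n (μ₀.prod μ₀)) :=
    ((MeasurePreserving.id _).prod Measure.measurePreserving_swap).comp
      (measurePreserving_prodAssoc _ _ _)
  have hz : MeasurePreserving (fun (p : (G → Fin (n + 1) × A) × (G → A)) g =>
      ((p.1 g).1, p.2 g, (p.1 g).2)) ((bern G (chainMeasure n μ₀)).prod (bern G μ₀))
      (bern G (chainMeasure n (μ₀.prod μ₀))) :=
    (measurePreserving_bernoulli_coord (fun _ => _) fun _ => hr).comp measurePreserving_bern_zip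
  exact exists_separation (Q := bern G (chainMeasure n μ₀)) (ergodic_bernoulli_smul_prod_prod hs)
    (measurePreserving_bernoulli_smul s) (measurePreserving_bernoulli_smul s)
    (a := ω s) (b := fun y : G → Fin (n + 1) × A => ω s fun g => (y g).2) (hΦ.comp hz.measurable)
    (hz.quasiMeasurePreserving.ae h)

end Untwist

section Propagation

variable {G : Type} [Group G] {H : Type} [Group H] [Countable H]
  [MeasurableSpace H] [DiscreteMeasurableSpace H] {A : Type} [MeasurableSpace A]
  {μ₀ : Measure A} [IsProbabilityMeasure μ₀]

/-- Weak mixing: a map intertwining the shift by an infinite order element with an inner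
automorphism of a countable group is constant. -/
lemma ae_const_of_conj {s : G} (hs : ¬ IsOfFinOrder s) (u : (G → A) → H) (hu : Measurable u)
    (α : H) (h : ∀ᵐ x ∂bern G μ₀, u (s • x) = α * u x * α⁻¹) :
    ∃ β, ∀ᵐ x ∂bern G μ₀, u x = β := by
  obtain ⟨β, hβ⟩ := exists_measure_fiber_pos (bern G μ₀) u
  refine ⟨β, ?_⟩
  have hE : MeasurableSet (u ⁻¹' {β}) := hu (measurableSet_singleton β)
  set E := u ⁻¹' {β}
  set p := (bern G μ₀).real E
  have hp : 0 < p := ENNReal.toReal_pos hβ.ne' (measure_ne_top _ _)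
  have hit : ∀ n : ℕ, ∀ᵐ x ∂bern G μ₀, u (s ^ n • x) = α ^ n * u x * (α ^ n)⁻¹ := by
    intro n
    induction n with
    | zero => simp
    | succ n ih =>
      filter_upwards [ih, (measurePreserving_bernoulli_smul (s ^ n)).quasiMeasurePreserving.ae h]
        with x h1 h2
      rw [pow_succ' s, mul_smul, h2, h1, pow_succ' α]
      group
  have hval : ∀ n : ℕ, (bern G μ₀).real (E ∩ (fun z => s ^ n • z) ⁻¹' E) ∈ ({0, p} : Set ℝ) := by
    intro n
    by_cases hc : α ^ n * β * (α ^ n)⁻¹ = β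
    · right
      refine measureReal_congr ?_
      filter_upwards [hit n] with x hx
      refine propext ⟨fun hx' => hx'.1, fun hx' => ⟨hx', ?_⟩⟩
      change u x = β at hx'
      change u (s ^ n • x) = β
      rw [hx, hx', hc]
    · left
      rw [measureReal_eq_zero_iff]
      refine measure_eq_zero_iff_ae_notMem.2 ?_
      filter_upwards [hit n] with x hx hx'
      have h1 : u x = β := hx'.1
      have h2 : u (s ^ n • x) = β := hx'.2
      rw [hx, h1] at h2
      exact hc h2
  have hlim := (bernoulli_mixing (m := μ₀) E E hE hE).comp (tendsto_pow_cofinite hs)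
  have hmem : p * p ∈ ({0, p} : Set ℝ) :=
    (Set.toFinite _).isClosed.mem_of_tendsto hlim (Filter.Eventually.of_forall hval)
  have hp1 : p = 1 := by
    rcases hmem with h0 | h0
    · nlinarith
    · have : p * p = p := h0
      nlinarith
  exact (mem_ae_iff_prob_eq_one hE).2 (by
    rw [← ENNReal.ofReal_one, ← hp1]; exact (ofReal_measureReal (measure_ne_top _ _)).symm)

/-- A cocycle that is constant on the first element of a chain-commuting generating family of
infinite order elements is a homomorphism. -/
lemma exists_hom_of_chain {k : ℕ} (hk : 0 < k) (s : Fin k → G)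
    (hgen : Subgroup.closure (Set.range s) = ⊤) (hord : ∀ i, ¬ IsOfFinOrder (s i))
    (hcomm : ∀ (i : ℕ) (h1 : i + 1 < k),
      Commute (s ⟨i, Nat.lt_of_succ_lt h1⟩) (s ⟨i + 1, h1⟩))
    (ω : G → (G → A) → H) (hω : ∀ g, Measurable (ω g))
    (hcoc : ∀ g h x, ω (g * h) x = ω g (h • x) * ω h x)
    (hconst : ∃ α, ∀ᵐ x ∂bern G μ₀, ω (s ⟨0, hk⟩) x = α) :
    ∃ α : G →* H, ∀ g, ∀ᵐ x ∂bern G μ₀, ω g x = α g := by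
  have hqmp := fun g : G =>
    (measurePreserving_bernoulli_smul (m := μ₀) g).quasiMeasurePreserving
  have hω1 : ∀ x, ω 1 x = 1 := fun x => by
    have := hcoc 1 1 x
    rwa [mul_one, one_smul, left_eq_mul] at this
  have hchain : ∀ (i : ℕ) (hi : i < k), ∃ α, ∀ᵐ x ∂bern G μ₀, ω (s ⟨i, hi⟩) x = α := by
    intro i
    induction i with
    | zero => exact fun _ => hconst
    | succ i ih =>
      intro hi
      obtain ⟨α, hα⟩ := ih (Nat.lt_of_succ_lt hi)
      refine ae_const_of_conj (hord ⟨i, Nat.lt_of_succ_lt hi⟩) _ (hω _) α ?_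
      filter_upwards [hα, (hqmp (s ⟨i + 1, hi⟩)).ae hα] with x h1 h2
      have h3 := hcoc (s ⟨i, Nat.lt_of_succ_lt hi⟩) (s ⟨i + 1, hi⟩) x
      rw [(hcomm i hi).eq, hcoc, h1, h2] at h3
      rw [← h3, mul_inv_cancel_right]
  let K : Subgroup G :=
    { carrier := {g | ∃ α, ∀ᵐ x ∂bern G μ₀, ω g x = α}
      one_mem' := ⟨1, Filter.Eventually.of_forall hω1⟩
      mul_mem' := by
        rintro g h ⟨α, hα⟩ ⟨β, hβ⟩
        refine ⟨α * β, ?_⟩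
        filter_upwards [(hqmp h).ae hα, hβ] with x h1 h2
        rw [hcoc, h1, h2]
      inv_mem' := by
        rintro g ⟨α, hα⟩
        refine ⟨α⁻¹, ?_⟩
        filter_upwards [(hqmp g⁻¹).ae hα] with x h1
        have h2 := hcoc g g⁻¹ x
        rw [mul_inv_cancel, hω1, h1] at h2
        exact eq_inv_of_mul_eq_one_right h2.symm }
  have hK : ∀ g, ∃ α, ∀ᵐ x ∂bern G μ₀, ω g x = α := fun g => by
    have h1 : Subgroup.closure (Set.range s) ≤ K := by
      rw [Subgroup.closure_le]
      rintro _ ⟨i, rfl⟩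
      exact hchain i.1 i.2
    exact h1 (hgen ▸ Subgroup.mem_top g)
  choose α hα using hK
  refine ⟨MonoidHom.mk' α fun g h => ?_, hα⟩
  obtain ⟨x, h1, h2, h3⟩ := (((hqmp h).ae (hα g)).and ((hα h).and (hα (g * h)))).exists
  rw [← h3, hcoc, h1, h2]

end Propagation

section OrbitEquivalence

/-- A property that holds almost everywhere holds on an invariant measurable conull set. -/
lemma exists_invariant_conull {G : Type} [Group G] [Countable G] {X : Type} [MeasurableSpace X]
    [MulAction G X] {μ : Measure X} (hG : PmpAction G X μ) {p : X → Prop} (hp : ∀ᵐ x ∂μ, p x) :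
    ∃ X₁ : Set X, MeasurableSet X₁ ∧ (∀ᵐ x ∂μ, x ∈ X₁) ∧ (∀ (g : G), ∀ x, g • x ∈ X₁ ↔ x ∈ X₁) ∧
      ∀ x ∈ X₁, p x := by
  obtain ⟨W, hW, hWm, hWp⟩ := hp.exists_measurable_mem
  refine ⟨⋂ g : G, (fun x => g • x) ⁻¹' W, MeasurableSet.iInter fun g => (hG g).measurable hWm,
    ?_, fun g x => ?_, fun x hx => ?_⟩
  · simp only [Set.mem_iInter]
    exact ae_all_iff.2 fun g => (hG g).quasiMeasurePreserving.ae hW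
  · simp only [Set.mem_iInter, Set.mem_preimage, smul_smul]
    exact ⟨fun h g' => by simpa using h (g' * g⁻¹), fun h g' => h (g' * g)⟩
  · exact hWp x (by simpa using Set.mem_iInter.1 hx 1)

variable {G : Type} [Group G] {X : Type} [MeasurableSpace X] [MulAction G X]
  {H : Type} [Group H] [Countable H] {Y : Type} [MeasurableSpace Y] [StandardBorelSpace Y]
  [MulAction H Y] {μ : Measure X} {ν : Measure Y}

/-- The orbit cocycle of an orbit equivalence with a free action. -/
lemma exists_orbit_cocycle [Countable G] [MeasurableSpace H] [DiscreteMeasurableSpace H]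
    (hG : PmpAction G X μ) (hH : PmpAction H Y ν) (hfree : FreeAction H Y ν)
    {F : X → Y} {F' : Y → X} (hF : MeasurePreserving F μ ν) (hF' : ∀ᵐ x ∂μ, F' (F x) = x)
    (horb : ∀ᵐ x ∂μ, F '' MulAction.orbit G x = MulAction.orbit H (F x)) :
    ∃ (X₁ : Set X) (ω : G → X → H), MeasurableSet X₁ ∧ (∀ᵐ x ∂μ, x ∈ X₁) ∧
      (∀ (g : G), ∀ x, g • x ∈ X₁ ↔ x ∈ X₁) ∧
      (∀ x ∈ X₁, F' (F x) = x ∧ F '' MulAction.orbit G x = MulAction.orbit H (F x) ∧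
        ∀ h : H, h • F x = F x → h = 1) ∧
      (∀ g, Measurable (ω g)) ∧ (∀ g h x, ω (g * h) x = ω g (h • x) * ω h x) ∧
      ∀ g, ∀ x ∈ X₁, F (g • x) = ω g x • F x := by
  classical
  have hfr : ∀ᵐ x ∂μ, ∀ h : H, h • F x = F x → h = 1 := by
    refine ae_all_iff.2 fun h => ?_
    by_cases hh : h = 1
    · simp [hh]
    · have h1 : ∀ᵐ y ∂ν, ¬ h • y = y := by
        rw [ae_iff]; simpa using hfree h hh
      filter_upwards [hF.quasiMeasurePreserving.ae h1] with x hx hx'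
      exact absurd hx' hx
  obtain ⟨X₁, hm, hae, hinv, hp⟩ := exists_invariant_conull hG (hF'.and (horb.and hfr))
  have hex : ∀ (g : G), ∀ x ∈ X₁, ∃ h : H, F (g • x) = h • F x := fun g x hx => by
    have h1 : F (g • x) ∈ MulAction.orbit H (F x) :=
      (hp x hx).2.1 ▸ ⟨g • x, ⟨g, rfl⟩, rfl⟩
    obtain ⟨h, hh⟩ := h1
    exact ⟨h, hh.symm⟩
  have huniq : ∀ x ∈ X₁, ∀ h h' : H, h • F x = h' • F x → h = h' := fun x hx h h' he => by
    have h1 := (hp x hx).2.2 (h'⁻¹ * h) (by rw [mul_smul, he, inv_smul_smul])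
    exact (inv_mul_eq_one.1 h1).symm
  let ω : G → X → H := fun g x => if hx : x ∈ X₁ then (hex g x hx).choose else 1
  have hω : ∀ g, ∀ x ∈ X₁, F (g • x) = ω g x • F x := fun g x hx => by
    simp only [ω, dif_pos hx]
    exact (hex g x hx).choose_spec
  have hω1 : ∀ g, ∀ x ∉ X₁, ω g x = 1 := fun g x hx => dif_neg hx
  refine ⟨X₁, ω, hm, hae, hinv, hp, fun g => measurable_to_countable' fun h => ?_,
    fun g h x => ?_, hω⟩
  · have h1 : MeasurableSet (X₁ ∩ {x | F (g • x) = h • F x}) :=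
      hm.inter (measurableSet_eq_fun (hF.measurable.comp (hG g).measurable)
        ((hH h).measurable.comp hF.measurable))
    have h2 : ω g ⁻¹' {h} = (X₁ ∩ {x | F (g • x) = h • F x}) ∪ (X₁ᶜ ∩ {_x | h = 1}) := by
      ext x
      by_cases hx : x ∈ X₁
      · simp only [Set.mem_preimage, Set.mem_singleton_iff, Set.mem_union, Set.mem_inter_iff, hx,
          true_and, Set.mem_compl_iff, not_true_eq_false, false_and, or_false, Set.mem_ofPred_eq,
          hω g x hx]
        exact ⟨fun he => he ▸ rfl, huniq x hx _ _⟩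
      · simp [hx, hω1 g x hx, eq_comm]
    rw [h2]
    exact h1.union (hm.compl.inter (MeasurableSet.const _))
  · by_cases hx : x ∈ X₁
    · refine huniq x hx _ _ ?_
      rw [← hω _ x hx, mul_smul, mul_smul, ← hω _ x hx, hω g _ ((hinv h x).2 hx)]
    · rw [hω1 _ x hx, hω1 _ x hx, hω1 g _ (fun h' => hx ((hinv h x).1 h')), mul_one]

/-- An orbit equivalence whose orbit cocycle is untwisted to an injective homomorphism is, up to
moving points within orbits, a conjugacy. -/
lemma conjugateActions_of_untwisted [StandardBorelSpace X] [IsProbabilityMeasure μ]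
    [IsProbabilityMeasure ν] [MeasurableSpace H] [DiscreteMeasurableSpace H]
    (hH : PmpAction H Y ν)
    {F : X → Y} {F' : Y → X} (hF : MeasurePreserving F μ ν) {X₁ : Set X} (hX₁ : MeasurableSet X₁)
    (hae : ∀ᵐ x ∂μ, x ∈ X₁) (hinv : ∀ (g : G), ∀ x, g • x ∈ X₁ ↔ x ∈ X₁)
    (hp : ∀ x ∈ X₁, F' (F x) = x ∧ F '' MulAction.orbit G x = MulAction.orbit H (F x) ∧
        ∀ h : H, h • F x = F x → h = 1)
    {q : X → H} (hq : Measurable q) (α : G →* H) (hα : Function.Injective α)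
    (hFα : ∀ g, ∀ x ∈ X₁, (q (g • x))⁻¹ • F (g • x) = α g • (q x)⁻¹ • F x) :
    ConjugateActions G X H Y μ ν := by
  set K : X → Y := fun x => (q x)⁻¹ • F x with hK
  have hFinj : Set.InjOn F X₁ := fun x hx y hy he => by
    rw [← (hp x hx).1, he, (hp y hy).1]
  have hfree : ∀ x ∈ X₁, ∀ h h' : H, h • K x = h' • K x → h = h' := fun x hx h h' he => by
    have h1 := (hp x hx).2.2 (q x * (h'⁻¹ * h) * (q x)⁻¹) (by
      rw [mul_smul, mul_smul, mul_smul]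
      change q x • h'⁻¹ • h • K x = F x
      rw [he, inv_smul_smul, hK, smul_inv_smul])
    rw [mul_inv_eq_one, mul_eq_left, inv_mul_eq_one] at h1
    exact h1.symm
  have hsame : ∀ x ∈ X₁, ∀ y ∈ X₁, ∀ h : H, K y = h • K x → ∃ g : G, y = g • x := by
    intro x hx y hy h he
    have h1 : F y ∈ MulAction.orbit H (F x) := ⟨q y * h * (q x)⁻¹, by
      change (q y * h * (q x)⁻¹) • F x = F y
      rw [mul_smul, mul_smul]
      change q y • h • K x = F y
      rw [← he, hK, smul_inv_smul]⟩
    rw [← (hp x hx).2.1] at h1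
    obtain ⟨_, ⟨g, rfl⟩, hg⟩ := h1
    exact ⟨g, hFinj hy ((hinv g x).2 hx) hg.symm⟩
  have hKm : Measurable K := by
    have h1 : Measurable fun p : H × Y => p.1⁻¹ • p.2 :=
      measurable_from_prod_countable_right fun h => (hH h⁻¹).measurable
    exact h1.comp (hq.prodMk hF.measurable)
  have hKinj : Set.InjOn K X₁ := by
    intro x hx y hy he
    obtain ⟨g, rfl⟩ := hsame x hx y hy 1 (by rw [one_smul, he])
    have h1 : g = 1 := hα (hfree x hx _ _ (by rw [← hFα g x hx, map_one, one_smul]; exact he.symm))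
    rw [h1, one_smul]
  have hKmp : MeasurePreserving K μ ν := by
    refine ⟨hKm, ?_⟩
    have : IsProbabilityMeasure (μ.map K) := Measure.isProbabilityMeasure_map hKm.aemeasurable
    refine Measure.eq_of_le_of_measure_univ_eq (Measure.le_iff.2 fun B hB => ?_) (by simp)
    rw [Measure.map_apply hKm hB]
    let D : H → Set X := fun h => X₁ ∩ (K ⁻¹' B ∩ q ⁻¹' {h})
    have hDm : ∀ h, MeasurableSet (D h) := fun h =>
      hX₁.inter ((hKm hB).inter (hq (measurableSet_singleton h)))
    have hDdisj : Pairwise (Function.onFun Disjoint D) := fun h h' hne =>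
      Set.disjoint_left.2 fun x hx hx' => hne (hx.2.2.symm.trans hx'.2.2)
    have hD : ∀ h, μ (D h) = ν (K '' D h) := fun h => by
      have h1 : MeasurableSet (F '' D h) := (hDm h).image_of_measurable_injOn hF.measurable
        (hFinj.mono Set.inter_subset_left)
      have h2 : K '' D h = (fun y => h • y) ⁻¹' (F '' D h) := by
        ext y
        constructor
        · rintro ⟨x, hx, rfl⟩
          have h3 : q x = h := hx.2.2
          exact ⟨x, hx, by simp only [hK, h3, smul_inv_smul]⟩
        · rintro ⟨x, hx, hxy⟩
          have h3 : q x = h := hx.2.2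
          exact ⟨x, hx, by simp only [hK, h3, hxy, inv_smul_smul]⟩
      rw [h2, (hH h).measure_preimage h1.nullMeasurableSet,
        ← hF.measure_preimage h1.nullMeasurableSet]
      refine measure_congr ?_
      filter_upwards [hae] with x hx
      refine propext ⟨fun hx' => ⟨x, hx', rfl⟩, ?_⟩
      rintro ⟨y, hy, hyx⟩
      have := hFinj hy.1 hx hyx
      exact this ▸ hy
    have hunion : μ (K ⁻¹' B) = μ (⋃ h, D h) := by
      refine measure_congr ?_
      filter_upwards [hae] with x hx
      refine propext ⟨fun hx' => Set.mem_iUnion.2 ⟨q x, hx, hx', rfl⟩, fun hx' => ?_⟩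
      obtain ⟨h, hh⟩ := Set.mem_iUnion.1 hx'
      exact hh.2.1
    rw [hunion, measure_iUnion hDdisj hDm, tsum_congr hD, ← measure_iUnion]
    · refine measure_mono (Set.iUnion_subset fun h => ?_)
      rintro _ ⟨x, hx, rfl⟩
      exact hx.2.1
    · intro h h' hne
      refine Set.disjoint_left.2 ?_
      rintro _ ⟨x, hx, rfl⟩ ⟨y, hy, hyx⟩
      have := hKinj hy.1 hx.1 hyx
      exact Set.disjoint_left.1 (hDdisj hne) hx (this ▸ hy)
    · exact fun h => (hDm h).image_of_measurable_injOn hKm (hKinj.mono Set.inter_subset_left)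
  have hrange : ∀ᵐ y ∂ν, y ∈ K '' X₁ := by
    have h1 : MeasurableSet (K '' X₁) := hX₁.image_of_measurable_injOn hKm hKinj
    rw [← hKmp.map_eq]
    refine (ae_map_iff hKm.aemeasurable h1).2 ?_
    filter_upwards [hae] with x hx using ⟨x, hx, rfl⟩
  have hsurj : Function.Surjective α := by
    intro h
    obtain ⟨_, ⟨x, hx, rfl⟩, x', hx', he⟩ :=
      (hrange.and ((hH h).quasiMeasurePreserving.ae hrange)).exists
    obtain ⟨g, rfl⟩ := hsame x hx x' hx' h he
    exact ⟨g, hfree x hx _ _ (by rw [← hFα g x hx]; exact he)⟩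
  refine ⟨MulEquiv.ofBijective α ⟨hα, hsurj⟩, K, ⟨hKm, hKmp, ?_⟩, fun g => ?_⟩
  · have := hX₁.standardBorel
    have hne : Nonempty X := nonempty_of_isProbabilityMeasure μ
    have hemb : MeasurableEmbedding fun x : X₁ => K x :=
      (hKm.comp measurable_subtype_coe).measurableEmbedding fun x y he =>
        Subtype.ext (hKinj x.2 y.2 he)
    obtain ⟨K', hK'm, hK'⟩ := hemb.exists_measurable_extend measurable_subtype_coe fun _ => hne
    have hK'' : ∀ x ∈ X₁, K' (K x) = x := fun x hx => congrFun hK' ⟨x, hx⟩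
    refine ⟨K', hK'm, hae.mono hK'', ?_⟩
    filter_upwards [hrange] with y hy
    obtain ⟨x, hx, rfl⟩ := hy
    rw [hK'' x hx]
  · exact hae.mono fun x hx => hFα g x hx

end OrbitEquivalence

section Kernel

lemma exists_measure_mem_Ioo {A : Type} [MeasurableSpace A] [StandardBorelSpace A]
    {m : Measure A} [IsProbabilityMeasure m] (hm : ∀ a, m {a} ≠ 1) :
    ∃ B, MeasurableSet B ∧ m B ≠ 0 ∧ m B ≠ 1 := by
  by_contra! h
  have : IsZeroOneMeasure m := ⟨fun B hB => or_iff_not_imp_left.2 (h B hB)⟩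
  obtain ⟨a, ha⟩ := IsZeroOneMeasure.exists_eq_dirac (μ := m)
  exact hm a (by rw [ha, Measure.dirac_apply' _ (measurableSet_singleton a)]; simp)

variable {G : Type} [Group G] {H : Type} [Countable H] [MeasurableSpace H]
  [DiscreteMeasurableSpace H] {A : Type} [MeasurableSpace A] [StandardBorelSpace A]
  {μ₀ : Measure A} [IsProbabilityMeasure μ₀]

/-- A countable valued map on a nontrivial Bernoulli shift takes equal values at distinct points
of infinite partial orbits. -/
lemma finite_of_smul_eq_of_eq (hμ₀ : ∀ a, μ₀ {a} ≠ 1) {q : (G → A) → H} (hq : Measurable q)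
    {N : Set G} (h : ∀ g ∈ N, ∀ᵐ x ∂bern G μ₀, q (g • x) = q x → g • x = x) : N.Finite := by
  by_contra hN
  obtain ⟨B₀, hB₀, h0, h1⟩ := exists_measure_mem_Ioo hμ₀
  obtain ⟨c, hc⟩ := exists_measure_fiber_pos (bern G μ₀) q
  have hE : MeasurableSet (q ⁻¹' {c}) := hq (measurableSet_singleton c)
  set E := q ⁻¹' {c}
  let B : Set (G → A) := {x | x 1 ∈ B₀}
  have hB : MeasurableSet B := measurable_pi_apply 1 hB₀
  have hBm : bern G μ₀ B = μ₀ B₀ :=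
    (measurePreserving_eval_infinitePi (fun _ : G => μ₀) 1).measure_preimage hB₀.nullMeasurableSet
  set p := (bern G μ₀).real E
  set b := (bern G μ₀).real B
  have hp : 0 < p := ENNReal.toReal_pos hc.ne' (measure_ne_top _ _)
  have hb0 : b ≠ 0 := fun hb => h0 (hBm ▸ (measureReal_eq_zero_iff).1 hb)
  have hb1 : b ≠ 1 := fun hb => h1 (by
    rw [← hBm, ← ENNReal.ofReal_one, ← hb]; exact (ofReal_measureReal (measure_ne_top _ _)).symm)
  have hNe : (Filter.cofinite ⊓ Filter.principal N).NeBot :=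
    Filter.cofinite_inf_principal_neBot_iff.2 hN
  have hval : ∀ D, MeasurableSet D → D ⊆ E → (bern G μ₀).real D ∈ ({0, p} : Set ℝ) := by
    intro D hD hDE
    have l1 := (bernoulli_mixing (m := μ₀) D E hD hE).mono_left
      (inf_le_left (b := Filter.principal N))
    have l2 := (bernoulli_mixing (m := μ₀) D D hD hD).mono_left
      (inf_le_left (b := Filter.principal N))
    have heq := tendsto_nhds_unique_of_eventuallyEq l1 l2 (by
      filter_upwards [Filter.mem_inf_of_right (Filter.mem_principal_self N)] with g hg
      refine measureReal_congr ?_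
      filter_upwards [h g hg] with x hx
      refine propext ⟨fun hx' => ⟨hx'.1, ?_⟩, fun hx' => ⟨hx'.1, hDE hx'.2⟩⟩
      have h2 : q x = c := hDE hx'.1
      have h3 : q (g • x) = c := hx'.2
      change g • x ∈ D
      rw [hx (h3.trans h2.symm)]
      exact hx'.1)
    rcases mul_eq_mul_left_iff.1 heq with h2 | h2
    · exact Or.inr h2.symm
    · exact Or.inl h2
  have : (Filter.cofinite : Filter G).NeBot := hNe.mono inf_le_left
  have hmem : p * b ∈ ({0, p} : Set ℝ) :=
    (Set.toFinite _).isClosed.mem_of_tendsto (bernoulli_mixing (m := μ₀) E B hE hB)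
      (Filter.Eventually.of_forall fun g =>
        hval _ (hE.inter (measurable_bernoulli_smul g hB)) Set.inter_subset_left)
  rcases hmem with h2 | h2
  · exact (mul_ne_zero hp.ne' hb0) h2
  · exact hb1 ((mul_eq_left₀ hp.ne').1 h2)

end Kernel

/-- Orbit equivalence superrigidity of Bernoulli actions of ICC groups with a
chain-commuting generating set of infinite-order elements, one of which has nonamenable
centralizer. -/
theorem stmt5
    (G : Type) [Group G] [Countable G] (hICC : IsICC G)
    (k : ℕ) (hk : 0 < k) (s : Fin k → G)
    (hgen : Subgroup.closure (Set.range s) = ⊤)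
    (hord : ∀ i : Fin k, ¬ IsOfFinOrder (s i))
    (hcomm : ∀ (i : ℕ) (h1 : i + 1 < k),
      Commute (s ⟨i, Nat.lt_of_succ_lt h1⟩) (s ⟨i + 1, h1⟩))
    (hcent : ¬ IsAmenable ↥(Subgroup.centralizer {s ⟨0, hk⟩}))
    (A : Type) [MeasurableSpace A] [StandardBorelSpace A]
    (μ₀ : Measure A) [IsProbabilityMeasure μ₀]
    (hnontriv : ∀ a : A, μ₀ {a} ≠ 1)
    (μ : Measure (G → A)) [IsProbabilityMeasure μ] (hber : IsBernoulliMeasure G μ₀ μ)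
    (H : Type) [Group H] [Countable H]
    (Y : Type) [MeasurableSpace Y] [StandardBorelSpace Y]
    (ν : Measure Y) [IsProbabilityMeasure ν] [MulAction H Y]
    (hYpmp : PmpAction H Y ν) (hYfree : FreeAction H Y ν) (hYerg : ErgodicAction H Y ν)
    (hOE : OrbitEquivalent G (G → A) H Y μ ν) :
    ConjugateActions G (G → A) H Y μ ν := by
  let _ : MeasurableSpace H := ⊤
  have : DiscreteMeasurableSpace H := ⟨fun _ => trivial⟩
  obtain rfl : μ = bern G μ₀ := Measure.eq_infinitePi _ fun s t ht => hber s t ht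
  obtain ⟨F, ⟨-, hF, F', -, hF', -⟩, horb⟩ := hOE
  have hG : PmpAction G (G → A) (bern G μ₀) := fun g => measurePreserving_bernoulli_smul g
  obtain ⟨X₁, ω, hX₁, hae₁, hinv₁, hp₁, hω, hcoc, hFω⟩ :=
    exists_orbit_cocycle hG hYpmp hYfree hF hF' horb
  obtain ⟨q, α₀, hq, hα₀⟩ := exists_untwist (μ₀ := μ₀) (Subgroup.centralizer {s ⟨0, hk⟩}) hcent
    (s ⟨0, hk⟩) (hord _) (fun c hc => (Subgroup.mem_centralizer_singleton_iff.1 hc).symm) ω hω hcoc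
  obtain ⟨α, hα⟩ := exists_hom_of_chain (μ₀ := μ₀) hk s hgen hord hcomm
    (fun g x => (q (g • x))⁻¹ * ω g x * q x)
    (fun g => ((hq.comp (measurable_bernoulli_smul g)).inv.mul (hω g)).mul hq)
    (fun g h x => by rw [hcoc, mul_smul]; group) ⟨α₀, hα₀⟩
  obtain ⟨X₂, hX₂, hae, hinv, hX⟩ := exists_invariant_conull hG (hae₁.and (ae_all_iff.2 hα))
  have hFα : ∀ g, ∀ x ∈ X₂, (q (g • x))⁻¹ • F (g • x) = α g • (q x)⁻¹ • F x := fun g x hx => by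
    rw [hFω g x (hX x hx).1, ← (hX x hx).2 g, smul_smul, smul_smul, mul_inv_cancel_right]
  have hker : (α.ker : Set G).Finite := finite_of_smul_eq_of_eq hnontriv hq fun g hg => by
    filter_upwards [hae] with x hx hqx
    have h1 := hFα g x hx
    rw [hqx, (MonoidHom.mem_ker).1 hg, one_smul] at h1
    rw [← (hp₁ _ ((hinv₁ g x).2 (hX x hx).1)).1, smul_left_cancel _ h1, (hp₁ x (hX x hx).1).1]
  have hinj : Function.Injective α := by
    refine (injective_iff_map_eq_one α).2 fun g hg => ?_
    by_contra hne
    refine hICC g hne (hker.subset ?_)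
    rintro _ ⟨c, rfl⟩
    simp [MonoidHom.mem_ker, hg]
  exact conjugateActions_of_untwisted hYpmp hF hX₂ hae hinv
    (fun x hx => hp₁ x (hX x hx).1) hq α hinj hFα

end OEPaper
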